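/- arXiv:2402.16597 — 4 statements merged into one kernel-verified Lean document; each statement's English description precedes it below -/
import Mathlib

section
/- Let n ≥ 3 and let ξ be a positive nonconstant periodic solution of (F). Then: (i) the kernel of L_0 has a basis p_0^+ and p_0^− + c t p_0^+, for some smooth periodic functions p_0^+ and p_0^− on ℝ and some constant c; (ii) there exists an increasing sequence of positive constants {ρ_i}_{i≥1}, divergent to ∞, such that for every i ≥ 1 the kernel of L_i has a basis e^{−ρ_i t} p_i^+ and e^{ρ_i t} p_i^− for some smooth periodic functions p_i^+, p_i^− on ℝ; moreover for i = 1,...,n, ρ_i = 1, p_i^+ = (n−2)/2 · ξ − ξ' and p_i^− = (n−2)/2 · ξ + ξ'. All the periodic functions above have the same period as ξ. -/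
open Real Set Metric Filter Function

noncomputable section

/-- The Euclidean Laplacian of `f` at `x`. -/
def lapE {n : ℕ} (f : EuclideanSpace ℝ (Fin n) → ℝ) (x : EuclideanSpace ℝ (Fin n)) : ℝ :=
  ∑ i : Fin n, iteratedFDeriv ℝ 2 f x ![EuclideanSpace.single i 1, EuclideanSpace.single i 1]

/-- The Laplace–Beltrami operator `Δ_θ` on the unit sphere `S^{n-1}`, computed via the
degree-zero homogeneous extension: for `θ` with `‖θ‖ = 1`, `sphLap f θ = Δ_θ f (θ)`. -/
def sphLap {n : ℕ} (f : EuclideanSpace ℝ (Fin n) → ℝ) (θ : EuclideanSpace ℝ (Fin n)) : ℝ :=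
  lapE (fun x => f (‖x‖⁻¹ • x)) θ

/-- Second derivative in the `t` variable. -/
def dtt (g : ℝ → ℝ) : ℝ → ℝ := deriv (deriv g)

/-- Dimension of the space of spherical harmonics on `S^{n-1}` of degree at most `d`. -/
def cumHarm (n d : ℕ) : ℕ := Nat.choose (n - 1 + d) (n - 1) + Nat.choose (n - 2 + d) (n - 1)

/-- The degree of the `i`-th spherical harmonic, eigenfunctions being listed with multiplicity. -/
def sphDeg (n i : ℕ) : ℕ := sInf {d | i < cumHarm n d}

/-- The `i`-th eigenvalue `λ_i` of `-Δ_θ` on `S^{n-1}`, listed in increasing order and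
repeated with multiplicity: `λ_i = d (n + d - 2)` where `d` is the degree of the `i`-th
spherical harmonic.  In particular `λ_0 = 0`, `λ_1 = ⋯ = λ_n = n - 1`, `λ_{n+1} = 2n`. -/
def sphEval (n i : ℕ) : ℝ := (sphDeg n i : ℝ) * ((n : ℝ) + (sphDeg n i : ℝ) - 2)

/-- The linearized operator `L_i = -d²/dt² + λ + (n-2)²/4 - ((n+2)/(n-2)) K(0) ξ^{4/(n-2)}`. -/
def Lop (n : ℕ) (K0 : ℝ) (ξ : ℝ → ℝ) (lam : ℝ) (h : ℝ → ℝ) : ℝ → ℝ :=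
  fun t => -dtt h t
    + (lam + ((n : ℝ) - 2) ^ 2 / 4
        - ((n : ℝ) + 2) / ((n : ℝ) - 2) * K0 * ξ t ^ ((4 : ℝ) / ((n : ℝ) - 2))) * h t

/-- The linearized operator `𝓛_i = -d²/dt² + λ + (n-2a-2)²/4 - (p-1) ζ^{p-2}` for the
Caffarelli-Kohn-Nirenberg equation. -/
def LopCKN (n : ℕ) (a p : ℝ) (ζ : ℝ → ℝ) (lam : ℝ) (h : ℝ → ℝ) : ℝ → ℝ :=
  fun t => -dtt h t + (lam + ((n : ℝ) - 2 * a - 2) ^ 2 / 4 - (p - 1) * ζ t ^ (p - 2)) * h t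

/-- `f, g` is a basis of the kernel of the second-order ODE operator `L` acting on `C²(ℝ)`. -/
def KerBasis (L : (ℝ → ℝ) → ℝ → ℝ) (f g : ℝ → ℝ) : Prop :=
  ContDiff ℝ 2 f ∧ ContDiff ℝ 2 g ∧ (∀ t, L f t = 0) ∧ (∀ t, L g t = 0) ∧
    LinearIndependent ℝ ![f, g] ∧
    ∀ h : ℝ → ℝ, ContDiff ℝ 2 h → (∀ t, L h t = 0) →
      ∃ c₁ c₂ : ℝ, ∀ t, h t = c₁ * f t + c₂ * g t

/-- `ξ` is a positive `T`-periodic solution of the Fowler equation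
`-ξ'' + ((n-2)²/4) ξ = K(0) ξ^{(n+2)/(n-2)}` on `ℝ`. -/
def FowlerXi (n : ℕ) (K0 : ℝ) (ξ : ℝ → ℝ) (T : ℝ) : Prop :=
  ContDiff ℝ 2 ξ ∧ (∀ t, 0 < ξ t) ∧ 0 < T ∧ Function.Periodic ξ T ∧
    ∀ t, -dtt ξ t + ((n : ℝ) - 2) ^ 2 / 4 * ξ t = K0 * ξ t ^ (((n : ℝ) + 2) / ((n : ℝ) - 2))

/-- `ζ` is a positive `T`-periodic solution of `-ζ'' + ((n-2a-2)²/4) ζ = ζ^{p-1}` on `ℝ`. -/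
def ZetaSol (n : ℕ) (a p : ℝ) (ζ : ℝ → ℝ) (T : ℝ) : Prop :=
  ContDiff ℝ 2 ζ ∧ (∀ t, 0 < ζ t) ∧ 0 < T ∧ Function.Periodic ζ T ∧
    ∀ t, -dtt ζ t + ((n : ℝ) - 2 * a - 2) ^ 2 / 4 * ζ t = ζ t ^ (p - 1)

/-- `ρ` is the increasing, divergent sequence of positive exponents such that, for every
`i ≥ 1`, the kernel of the linearized operator `L_i` at the Fowler solution `ξ` has a basis
`e^{-ρ_i t} p_i⁺(t)`, `e^{ρ_i t} p_i⁻(t)` with `p_i^±` smooth and `T`-periodic. -/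
def FowlerExponents (n : ℕ) (K0 : ℝ) (ξ : ℝ → ℝ) (T : ℝ) (ρ : ℕ → ℝ) : Prop :=
  (∀ i, 1 ≤ i → 0 < ρ i) ∧ (∀ i j, 1 ≤ i → i ≤ j → ρ i ≤ ρ j) ∧
    Tendsto ρ atTop atTop ∧
    ∀ i, 1 ≤ i → ∃ p₁ p₂ : ℝ → ℝ, ContDiff ℝ (⊤ : ℕ∞) p₁ ∧ ContDiff ℝ (⊤ : ℕ∞) p₂ ∧
      Function.Periodic p₁ T ∧ Function.Periodic p₂ T ∧
      KerBasis (Lop n K0 ξ (sphEval n i))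
        (fun t => Real.exp (-(ρ i) * t) * p₁ t) (fun t => Real.exp (ρ i * t) * p₂ t)

/-- Analogue of `FowlerExponents` for the CKN linearized operators `𝓛_i`. -/
def CKNExponents (n : ℕ) (a p : ℝ) (ζ : ℝ → ℝ) (T : ℝ) (σ : ℕ → ℝ) : Prop :=
  (∀ i, 1 ≤ i → 0 < σ i) ∧ (∀ i j, 1 ≤ i → i ≤ j → σ i ≤ σ j) ∧
    Tendsto σ atTop atTop ∧
    ∀ i, 1 ≤ i → ∃ q₁ q₂ : ℝ → ℝ, ContDiff ℝ (⊤ : ℕ∞) q₁ ∧ ContDiff ℝ (⊤ : ℕ∞) q₂ ∧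
      Function.Periodic q₁ T ∧ Function.Periodic q₂ T ∧
      KerBasis (LopCKN n a p ζ (sphEval n i))
        (fun t => Real.exp (-(σ i) * t) * q₁ t) (fun t => Real.exp (σ i * t) * q₂ t)

/-- The index set `{ Σ_{i≥1} nᵢ ρᵢ > 0 : nᵢ ∈ ℕ, finitely many nᵢ > 0 }`. -/
def IndexSet (ρ : ℕ → ℝ) : Set ℝ :=
  {s | 0 < s ∧ ∃ f : ℕ →₀ ℕ, (∀ i ∈ f.support, 1 ≤ i) ∧
    s = ∑ i ∈ f.support, (f i : ℝ) * ρ i}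

/-- `v` is a positive solution on `(t₀, ∞) × S^{n-1}` of the cylindrical conformal scalar
curvature equation `-v_tt - Δ_θ v + ((n-2)²/4) v = K(e^{-t}θ) v^{(n+2)/(n-2)}`. -/
def SolCyl (n : ℕ) (K : EuclideanSpace ℝ (Fin n) → ℝ)
    (v : ℝ → EuclideanSpace ℝ (Fin n) → ℝ) (t₀ : ℝ) : Prop :=
  (∀ t θ, t₀ < t → ‖θ‖ = 1 → 0 < v t θ) ∧
    ∀ (t : ℝ) (θ : EuclideanSpace ℝ (Fin n)), t₀ < t → ‖θ‖ = 1 →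
      -dtt (fun s => v s θ) t - sphLap (v t) θ + ((n : ℝ) - 2) ^ 2 / 4 * v t θ
        = K (Real.exp (-t) • θ) * v t θ ^ (((n : ℝ) + 2) / ((n : ℝ) - 2))

/-- `w` is a positive solution on `(t₀, ∞) × S^{n-1}` of the cylindrical CKN equation
`-w_tt - Δ_θ w + ((n-2a-2)²/4) w = w^{p-1}`. -/
def SolCylW (n : ℕ) (a p : ℝ) (w : ℝ → EuclideanSpace ℝ (Fin n) → ℝ) (t₀ : ℝ) : Prop :=
  (∀ t θ, t₀ < t → ‖θ‖ = 1 → 0 < w t θ) ∧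
    ∀ (t : ℝ) (θ : EuclideanSpace ℝ (Fin n)), t₀ < t → ‖θ‖ = 1 →
      -dtt (fun s => w s θ) t - sphLap (w t) θ + ((n : ℝ) - 2 * a - 2) ^ 2 / 4 * w t θ
        = w t θ ^ (p - 1)

/-- `v(t, θ) → ξ(t)` as `t → ∞`, uniformly for `θ ∈ S^{n-1}`. -/
def UnifConv {n : ℕ} (v : ℝ → EuclideanSpace ℝ (Fin n) → ℝ) (ξ : ℝ → ℝ) : Prop :=
  ∀ ε > 0, ∃ T : ℝ, ∀ t ≥ T, ∀ θ : EuclideanSpace ℝ (Fin n), ‖θ‖ = 1 → |v t θ - ξ t| < ε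

/-- The degree-zero homogeneous (in the sphere variable) representative of a function on the
cylinder `ℝ × S^{n-1}`. -/
def cylRep {n : ℕ} (F : ℝ → EuclideanSpace ℝ (Fin n) → ℝ) :
    ℝ × EuclideanSpace ℝ (Fin n) → ℝ :=
  fun pt => F pt.1 (‖pt.2‖⁻¹ • pt.2)

/-- The norm of the intrinsic gradient on the cylinder `ℝ × S^{n-1}` at `(t, θ)`. -/
def cylGrad {n : ℕ} (F : ℝ → EuclideanSpace ℝ (Fin n) → ℝ) (t : ℝ)
    (θ : EuclideanSpace ℝ (Fin n)) : ℝ :=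
  ‖fderiv ℝ (cylRep F) (t, θ)‖

/-- Membership in `C^{2,α}` of a region `s` of the cylinder. -/
def CylC2Holder {n : ℕ} (α : ℝ) (s : Set (ℝ × EuclideanSpace ℝ (Fin n)))
    (F : ℝ → EuclideanSpace ℝ (Fin n) → ℝ) : Prop :=
  ContDiffOn ℝ 2 (cylRep F) s ∧
    ∃ C : ℝ, ∀ p ∈ s, ∀ q ∈ s,
      ‖iteratedFDerivWithin ℝ 2 (cylRep F) s p - iteratedFDerivWithin ℝ 2 (cylRep F) s q‖
        ≤ C * ‖p - q‖ ^ α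

/-- A bounded smooth function on `(t₀, ∞) × S^{n-1}`. -/
def BddSmoothCyl {n : ℕ} (t₀ : ℝ) (c : ℝ → EuclideanSpace ℝ (Fin n) → ℝ) : Prop :=
  ContDiffOn ℝ (⊤ : ℕ∞) (cylRep c)
      ((Ioi t₀) ×ˢ {x : EuclideanSpace ℝ (Fin n) | x ≠ 0}) ∧
    ∃ M : ℝ, ∀ t θ, t₀ < t → ‖θ‖ = 1 → |c t θ| ≤ M

/-- The nonlinear operator `𝓜(f) = -f_tt - Δ_θ f + ((n-2)²/4) f - K f^{(n+2)/(n-2)}`. -/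
def Mop (n : ℕ) (K : EuclideanSpace ℝ (Fin n) → ℝ)
    (f : ℝ → EuclideanSpace ℝ (Fin n) → ℝ) (t : ℝ) (θ : EuclideanSpace ℝ (Fin n)) : ℝ :=
  -dtt (fun s => f s θ) t - sphLap (f t) θ + ((n : ℝ) - 2) ^ 2 / 4 * f t θ
    - K (Real.exp (-t) • θ) * f t θ ^ (((n : ℝ) + 2) / ((n : ℝ) - 2))

/-- The nonlinear operator `𝓝(f) = -f_tt - Δ_θ f + ((n-2a-2)²/4) f - f^{p-1}`. -/
def Nop (n : ℕ) (a p : ℝ)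
    (f : ℝ → EuclideanSpace ℝ (Fin n) → ℝ) (t : ℝ) (θ : EuclideanSpace ℝ (Fin n)) : ℝ :=
  -dtt (fun s => f s θ) t - sphLap (f t) θ + ((n : ℝ) - 2 * a - 2) ^ 2 / 4 * f t θ
    - f t θ ^ (p - 1)

/-- `y` solves `y'' = Q y` with derivative `y1`. -/
def Sol (Q y y1 : ℝ → ℝ) : Prop :=
  (∀ t, HasDerivAt y (y1 t) t) ∧ (∀ t, HasDerivAt y1 (Q t * y t) t)

/-- Picard iterates. -/
def pic (Q : ℝ → ℝ) (a b : ℝ) : ℕ → (ℝ → ℝ) × (ℝ → ℝ)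
  | 0 => (fun _ => a, fun _ => b)
  | k + 1 => (fun t => ∫ s in (0:ℝ)..t, (pic Q a b k).2 s,
      fun t => ∫ s in (0:ℝ)..t, Q s * (pic Q a b k).1 s)

theorem pic_cont {Q : ℝ → ℝ} (hQ : Continuous Q) (a b : ℝ) (k : ℕ) :
    Continuous (pic Q a b k).1 ∧ Continuous (pic Q a b k).2 := by
  induction k with
  | zero => exact ⟨continuous_const, continuous_const⟩
  | succ k ih =>
    obtain ⟨h1, h2⟩ := ih
    constructor
    · exact intervalIntegral.continuous_primitive (fun _ _ => h2.intervalIntegrable _ _) 0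
    · exact intervalIntegral.continuous_primitive
        (fun _ _ => (hQ.mul h1).intervalIntegrable _ _) 0

theorem pic_deriv1 {Q : ℝ → ℝ} (hQ : Continuous Q) (a b : ℝ) (k : ℕ) (t : ℝ) :
    HasDerivAt (pic Q a b (k+1)).1 ((pic Q a b k).2 t) t :=
  (pic_cont hQ a b k).2.integral_hasStrictDerivAt 0 t |>.hasDerivAt

theorem pic_deriv2 {Q : ℝ → ℝ} (hQ : Continuous Q) (a b : ℝ) (k : ℕ) (t : ℝ) :
    HasDerivAt (pic Q a b (k+1)).2 (Q t * (pic Q a b k).1 t) t :=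
  (hQ.mul (pic_cont hQ a b k).1).integral_hasStrictDerivAt 0 t |>.hasDerivAt

theorem int_bound {f : ℝ → ℝ} (hf : Continuous f) {C : ℝ} {k : ℕ}
    (h : ∀ t, |f t| ≤ C * |t| ^ k) (t : ℝ) :
    |∫ s in (0:ℝ)..t, f s| ≤ C * (|t| ^ (k+1) / (k+1)) := by
  have h1 : ‖∫ s in (0:ℝ)..t, f s‖ ≤ ∫ s in Set.uIoc 0 t, ‖f s‖ :=
    intervalIntegral.norm_integral_le_integral_norm_uIoc
  have h2 : ∫ s in Set.uIoc 0 t, ‖f s‖ ≤ ∫ s in Set.uIoc 0 t, C * |s - 0| ^ k := by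
    apply MeasureTheory.setIntegral_mono_on
    · exact (intervalIntegrable_iff.1 (hf.norm.intervalIntegrable 0 t))
    · exact (intervalIntegrable_iff.1
        ((by fun_prop : Continuous fun s : ℝ => C * |s - 0| ^ k).intervalIntegrable 0 t))
    · exact measurableSet_uIoc
    · intro x _
      simpa using h x
  rw [MeasureTheory.integral_const_mul, integral_pow_abs_sub_uIoc] at h2
  simpa using h1.trans h2

theorem pic_bound {Q : ℝ → ℝ} (hQ : Continuous Q) {M : ℝ} (hM1 : 1 ≤ M) (hM : ∀ t, |Q t| ≤ M)
    (a b : ℝ) (k : ℕ) :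
    (∀ t, |(pic Q a b k).1 t| ≤ (|a| + |b|) * M ^ k / k.factorial * |t| ^ k) ∧
    (∀ t, |(pic Q a b k).2 t| ≤ (|a| + |b|) * M ^ k / k.factorial * |t| ^ k) := by
  induction k with
  | zero => simp [pic]
  | succ k ih =>
    obtain ⟨h1, h2⟩ := ih
    obtain ⟨c1, c2⟩ := pic_cont hQ a b k
    have hM0 : 0 ≤ M := by linarith
    have e : ∀ t : ℝ, (|a| + |b|) * M ^ (k+1) / (k+1).factorial * |t| ^ (k+1)
        = (|a| + |b|) * M ^ k / k.factorial * M * (|t| ^ (k+1) / (k+1)) := by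
      intro t
      rw [Nat.factorial_succ]; push_cast
      have : (k.factorial : ℝ) ≠ 0 := by positivity
      field_simp
      ring
    constructor
    · intro t
      rw [e]
      refine int_bound c2 (fun s => (h2 s).trans ?_) t
      have : 0 ≤ (|a| + |b|) * M ^ k / k.factorial := by positivity
      have := mul_le_mul_of_nonneg_left hM1 this
      rw [mul_one] at this
      gcongr
    · intro t
      rw [e]
      refine int_bound (hQ.mul c1) (fun s => ?_) t
      rw [Pi.mul_apply, abs_mul]
      calc |Q s| * |(pic Q a b k).1 s| ≤ M * ((|a| + |b|) * M ^ k / k.factorial * |s| ^ k) := by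
            gcongr
            · exact hM s
            · exact h1 s
        _ = _ := by ring

theorem pic_summ (C M R : ℝ) : Summable fun k : ℕ => C * M ^ k / k.factorial * R ^ k := by
  have := (Real.summable_pow_div_factorial (M * R)).mul_left C
  refine this.congr fun k => ?_
  rw [mul_pow]; ring

theorem exists_sol {Q : ℝ → ℝ} (hQ : Continuous Q) {M : ℝ} (hM : ∀ t, |Q t| ≤ M) (a b : ℝ) :
    ∃ y y1, Sol Q y y1 ∧ y 0 = a ∧ y1 0 = b := by
  obtain ⟨N, hN1, hN⟩ : ∃ N, 1 ≤ N ∧ ∀ t, |Q t| ≤ N :=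
    ⟨max 1 M, le_max_left _ _, fun t => (hM t).trans (le_max_right _ _)⟩
  have hN0 : 0 ≤ N := by linarith
  have B := pic_bound hQ hN1 hN a b
  have S1 : ∀ t, Summable fun k => (pic Q a b k).1 t := fun t =>
    Summable.of_norm_bounded (pic_summ _ _ _) fun k => (B k).1 t
  have S2 : ∀ t, Summable fun k => (pic Q a b k).2 t := fun t =>
    Summable.of_norm_bounded (pic_summ _ _ _) fun k => (B k).2 t
  have Z1 : ∀ k, (pic Q a b (k+1)).1 0 = 0 := fun k => by simp [pic]
  have Z2 : ∀ k, (pic Q a b (k+1)).2 0 = 0 := fun k => by simp [pic]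
  have key : ∀ t : ℝ, t ∈ Set.Ioo (-(|t|+1)) (|t|+1) := fun t =>
    ⟨by have := neg_abs_le t; linarith, by have := le_abs_self t; linarith⟩
  refine ⟨fun t => ∑' k, (pic Q a b k).1 t, fun t => ∑' k, (pic Q a b k).2 t, ⟨?_, ?_⟩, ?_, ?_⟩
  · intro t
    have e : (fun t => ∑' k, (pic Q a b k).1 t) = fun t => a + ∑' k, (pic Q a b (k+1)).1 t := by
      funext t; rw [(S1 t).tsum_eq_zero_add]; rfl
    rw [e]
    refine HasDerivAt.const_add _ ?_
    refine hasDerivAt_tsum_of_isPreconnected (pic_summ (|a|+|b|) N (|t|+1)) isOpen_Ioo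
      isPreconnected_Ioo (fun k y _ => pic_deriv1 hQ a b k y) (fun k y hy => ?_) (key t)
      ((summable_nat_add_iff 1).2 (S1 t)) (key t)
    refine ((B k).2 y).trans ?_
    have : |y| ≤ |t| + 1 := abs_le.2 ⟨hy.1.le, hy.2.le⟩
    gcongr
  · intro t
    have e : (fun t => ∑' k, (pic Q a b k).2 t) = fun t => b + ∑' k, (pic Q a b (k+1)).2 t := by
      funext t; rw [(S2 t).tsum_eq_zero_add]; rfl
    rw [e, ← tsum_mul_left]
    refine HasDerivAt.const_add _ ?_
    refine hasDerivAt_tsum_of_isPreconnected ((pic_summ (|a|+|b|) N (|t|+1)).mul_left N) isOpen_Ioo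
      isPreconnected_Ioo (fun k y _ => pic_deriv2 hQ a b k y) (fun k y hy => ?_) (key t)
      ((summable_nat_add_iff 1).2 (S2 t)) (key t)
    have : |y| ≤ |t| + 1 := abs_le.2 ⟨hy.1.le, hy.2.le⟩
    rw [norm_mul]
    refine mul_le_mul (hN y) (((B k).1 y).trans ?_) (norm_nonneg _) hN0
    gcongr
  · simp only []
    rw [(S1 0).tsum_eq_zero_add]; simp [Z1]; rfl
  · simp only []
    rw [(S2 0).tsum_eq_zero_add]; simp [Z2]; rfl

theorem Sol.wronsk {Q f f1 g g1 : ℝ → ℝ} (hf : Sol Q f f1) (hg : Sol Q g g1) (t s : ℝ) :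
    f t * g1 t - f1 t * g t = f s * g1 s - f1 s * g s := by
  have h : ∀ t, HasDerivAt (fun t => f t * g1 t - f1 t * g t) 0 t := by
    intro t
    have := ((hf.1 t).mul (hg.2 t)).sub ((hf.2 t).mul (hg.1 t))
    convert! this using 1
    ring
  exact is_const_of_deriv_eq_zero (fun t => (h t).differentiableAt) (fun t => (h t).deriv) t s

theorem Sol.span {Q f f1 g g1 h h1 : ℝ → ℝ} (hf : Sol Q f f1) (hg : Sol Q g g1) (hh : Sol Q h h1)
    (hW : f 0 * g1 0 - f1 0 * g 0 ≠ 0) :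
    ∃ c₁ c₂ : ℝ, ∀ t, h t = c₁ * f t + c₂ * g t ∧ h1 t = c₁ * f1 t + c₂ * g1 t := by
  set W := f 0 * g1 0 - f1 0 * g 0 with hWd
  refine ⟨(h 0 * g1 0 - h1 0 * g 0) / W, (f 0 * h1 0 - f1 0 * h 0) / W, fun t => ?_⟩
  have a1 := hf.wronsk hg t 0
  have a2 := hh.wronsk hg t 0
  have a3 := hf.wronsk hh t 0
  rw [← a2, ← a3]
  rw [← hWd] at a1
  constructor
  · field_simp
    rw [← a1]; ring
  · field_simp
    rw [← a1]; ring

theorem Sol.comb {Q f f1 g g1 : ℝ → ℝ} (hf : Sol Q f f1) (hg : Sol Q g g1) (a b : ℝ) :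
    Sol Q (fun t => a * f t + b * g t) (fun t => a * f1 t + b * g1 t) := by
  constructor
  · intro t; exact ((hf.1 t).const_mul a).add ((hg.1 t).const_mul b)
  · intro t
    convert! ((hf.2 t).const_mul a).add ((hg.2 t).const_mul b) using 1
    ring

theorem Sol.shift {Q f f1 : ℝ → ℝ} (hf : Sol Q f f1) {T : ℝ} (hQ : Function.Periodic Q T) :
    Sol Q (fun t => f (t + T)) (fun t => f1 (t + T)) := by
  constructor
  · intro t; exact (hf.1 (t+T)).comp_add_const t T
  · intro t
    have := (hf.2 (t+T)).comp_add_const t T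
    rwa [hQ t] at this

theorem Sol.smooth {Q f f1 : ℝ → ℝ} (hf : Sol Q f f1) (hQ : ContDiff ℝ (⊤ : ℕ∞) Q) :
    ContDiff ℝ (⊤ : ℕ∞) f ∧ ContDiff ℝ (⊤ : ℕ∞) f1 := by
  have d0 : deriv f = f1 := funext fun t => (hf.1 t).deriv
  have d1 : deriv f1 = fun t => Q t * f t := funext fun t => (hf.2 t).deriv
  have D0 : Differentiable ℝ f := fun t => (hf.1 t).differentiableAt
  have D1 : Differentiable ℝ f1 := fun t => (hf.2 t).differentiableAt
  have key : ∀ k : ℕ, ContDiff ℝ k f ∧ ContDiff ℝ k f1 := by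
    intro k
    induction k with
    | zero => exact ⟨contDiff_zero.2 D0.continuous, contDiff_zero.2 D1.continuous⟩
    | succ k ih =>
      push_cast
      rw [contDiff_succ_iff_deriv, contDiff_succ_iff_deriv, d0, d1]
      refine ⟨⟨D0, by simp, ih.2⟩, D1, by simp, ?_⟩
      exact (hQ.of_le (by exact_mod_cast le_top)).mul ih.1
  exact ⟨contDiff_infty.2 fun k => (key k).1, contDiff_infty.2 fun k => (key k).2⟩

theorem cone_aux {u W α β : ℝ → ℝ} (hu : ∀ t, HasDerivAt u (α t * W t) t)
    (hW : ∀ t, HasDerivAt W (β t * u t) t) (hα : ∀ t, 0 ≤ α t) (hβ : ∀ t, 0 ≤ β t)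
    (u0 : 0 < u 0) (W0 : 0 ≤ W 0) (t : ℝ) (ht : 0 ≤ t) : u 0 ≤ u t ∧ W 0 ≤ W t := by
  have cu : Continuous u := continuous_iff_continuousAt.2 fun t => (hu t).continuousAt
  have m1 : Monotone fun t => u t * W t := by
    refine monotone_of_hasDerivAt_nonneg (fun t => (hu t).mul (hW t)) fun t => ?_
    have := mul_nonneg (hα t) (sq_nonneg (W t))
    have := mul_nonneg (hβ t) (sq_nonneg (u t))
    simp only [Pi.zero_apply]
    nlinarith
  have p1 : ∀ t, 0 ≤ t → 0 ≤ u t * W t := fun t ht =>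
    (mul_nonneg u0.le W0).trans (m1 ht)
  have m2 : MonotoneOn (fun t => u t ^ 2) (Set.Ici 0) := by
    refine monotoneOn_of_deriv_nonneg (convex_Ici 0) (by fun_prop)
      (fun t _ => ((hu t).pow 2).differentiableAt.differentiableWithinAt) fun t ht => ?_
    have hd : HasDerivAt (fun t => u t ^ 2) _ t := (hu t).pow 2
    rw [hd.deriv]
    simp only [interior_Ici, Set.mem_Ioi] at ht
    have := mul_nonneg (hα t) (p1 t ht.le)
    norm_num
    nlinarith
  have p2 : ∀ t, 0 ≤ t → 0 < u t := by
    intro t ht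
    by_contra hc
    push Not at hc
    obtain ⟨s, hs, hs0⟩ := intermediate_value_Icc' ht cu.continuousOn ⟨hc, u0.le⟩
    have := m2 (Set.mem_Ici.2 le_rfl) (Set.mem_Ici.2 hs.1) hs.1
    simp only [hs0] at this
    nlinarith
  have p3 : ∀ t, 0 ≤ t → 0 ≤ W t := fun t ht => nonneg_of_mul_nonneg_right (p1 t ht) (p2 t ht)
  have cW : Continuous W := continuous_iff_continuousAt.2 fun t => (hW t).continuousAt
  have m3 : MonotoneOn u (Set.Ici 0) := by
    refine monotoneOn_of_deriv_nonneg (convex_Ici 0) cu.continuousOn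
      (fun t _ => (hu t).differentiableAt.differentiableWithinAt) fun t ht => ?_
    rw [(hu t).deriv]
    simp only [interior_Ici, Set.mem_Ioi] at ht
    exact mul_nonneg (hα t) (p3 t ht.le)
  have m4 : MonotoneOn W (Set.Ici 0) := by
    refine monotoneOn_of_deriv_nonneg (convex_Ici 0) cW.continuousOn
      (fun t _ => (hW t).differentiableAt.differentiableWithinAt) fun t ht => ?_
    rw [(hW t).deriv]
    simp only [interior_Ici, Set.mem_Ioi] at ht
    exact mul_nonneg (hβ t) (p2 t ht.le).le
  exact ⟨m3 (Set.mem_Ici.2 le_rfl) (Set.mem_Ici.2 ht) ht,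
    m4 (Set.mem_Ici.2 le_rfl) (Set.mem_Ici.2 ht) ht⟩

theorem cone {Q1 Q2 z z1 h h1 : ℝ → ℝ} (hz : Sol Q1 z z1) (zp : ∀ t, 0 < z t)
    (hQ : ∀ t, Q1 t ≤ Q2 t) (hh : Sol Q2 h h1)
    (H : (0 < h 0 ∧ 0 ≤ z 0 * h1 0 - z1 0 * h 0) ∨ (0 ≤ h 0 ∧ 0 < z 0 * h1 0 - z1 0 * h 0))
    (t : ℝ) (ht : 0 ≤ t) : h 0 / z 0 ≤ h t / z t ∧ 0 ≤ z t * h1 t - z1 t * h t := by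
  have du : ∀ t, HasDerivAt (fun t => h t / z t) ((z t ^ 2)⁻¹ * (z t * h1 t - z1 t * h t)) t := by
    intro t
    have := (hh.1 t).div (hz.1 t) (zp t).ne'
    convert! this using 1
    have := (zp t).ne'
    field_simp
  have dW : ∀ t, HasDerivAt (fun t => z t * h1 t - z1 t * h t)
      (((Q2 t - Q1 t) * z t ^ 2) * (h t / z t)) t := by
    intro t
    have := ((hz.1 t).mul (hh.2 t)).sub ((hz.2 t).mul (hh.1 t))
    convert! this using 1
    have := (zp t).ne'
    field_simp
    ring
  have ha : ∀ t, 0 ≤ (z t ^ 2)⁻¹ := fun t => by positivity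
  have hb : ∀ t, 0 ≤ (Q2 t - Q1 t) * z t ^ 2 := fun t =>
    mul_nonneg (sub_nonneg.2 (hQ t)) (sq_nonneg _)
  rcases H with ⟨H1, H2⟩ | ⟨H1, H2⟩
  · obtain ⟨r1, r2⟩ := cone_aux du dW ha hb (div_pos H1 (zp 0)) H2 t ht
    exact ⟨r1, H2.trans r2⟩
  · obtain ⟨r1, r2⟩ := cone_aux dW du hb ha H2 (div_nonneg H1 (zp 0).le) t ht
    exact ⟨r2, H2.le.trans r1⟩

/-- Floquet data. -/
def Fl (Q : ℝ → ℝ) (T ρ : ℝ) (P1 P2 : ℝ → ℝ) : Prop :=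
  0 < ρ ∧ ContDiff ℝ (⊤ : ℕ∞) P1 ∧ ContDiff ℝ (⊤ : ℕ∞) P2 ∧ Function.Periodic P1 T ∧
    Function.Periodic P2 T ∧ (∀ t, 0 < P2 t) ∧
    ∃ f1 g1, Sol Q (fun t => Real.exp (-ρ * t) * P1 t) f1 ∧
      Sol Q (fun t => Real.exp (ρ * t) * P2 t) g1 ∧
      (Real.exp (-ρ * 0) * P1 0) * g1 0 - f1 0 * (Real.exp (ρ * 0) * P2 0) ≠ 0

set_option maxHeartbeats 2000000 in
theorem fl_exists {Q1 Q2 z z1 : ℝ → ℝ} {T ρ₁ M : ℝ} (hT : 0 < T) (hρ : 0 < ρ₁) (hz : Sol Q1 z z1)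
    (zp : ∀ t, 0 < z t) (zT : ∀ t, z (t + T) = Real.exp (ρ₁ * T) * z t)
    (hQ : ∀ t, Q1 t ≤ Q2 t) (sQ : ContDiff ℝ (⊤ : ℕ∞) Q2) (pQ : Function.Periodic Q2 T)
    (bQ : ∀ t, |Q2 t| ≤ M) : ∃ ρ P1 P2, ρ₁ ≤ ρ ∧ Fl Q2 T ρ P1 P2 := by
  have z1T : z1 T = Real.exp (ρ₁ * T) * z1 0 := by
    have e1 : HasDerivAt (fun t => z (t + T)) (z1 (0+T)) 0 := (hz.1 (0+T)).comp_add_const 0 T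
    have e2 : HasDerivAt (fun t => z (t + T)) (Real.exp (ρ₁ * T) * z1 0) 0 := by
      simp_rw [zT]
      exact (hz.1 0).const_mul _
    have := e1.unique e2
    simpa using this
  have z0T : z T = Real.exp (ρ₁ * T) * z 0 := by simpa using zT 0
  have z0p := zp 0
  set E := Real.exp (ρ₁ * T) with hE
  have E1 : 1 < E := by rw [hE]; exact Real.one_lt_exp_iff.2 (by positivity)
  obtain ⟨h, h1, hh, h0, h10⟩ := exists_sol sQ.continuous bQ (z 0) (z1 0)
  obtain ⟨r, r1, hr, r0, r10⟩ := exists_sol sQ.continuous bQ 0 1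
  have W0 : h 0 * r1 0 - h1 0 * r 0 = z 0 := by rw [h0, r0, r10]; ring
  have W0' : h 0 * r1 0 - h1 0 * r 0 ≠ 0 := by rw [W0]; exact z0p.ne'
  obtain ⟨a, c, hac⟩ := hh.span hr (hh.shift pQ) W0'
  obtain ⟨b, d, hbd⟩ := hh.span hr (hr.shift pQ) W0'
  have hT1 := hac 0
  have hT2 := hbd 0
  simp only [zero_add, h0, h10, r0, r10, mul_zero, add_zero, mul_one] at hT1 hT2
  have Ch := fun t ht => cone hz zp hQ hh (Or.inl ⟨by rw [h0]; exact z0p, by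
    rw [h0, h10]; apply le_of_eq; ring⟩) t ht
  have Cr := cone hz zp hQ hr (Or.inr ⟨by rw [r0], by
    rw [r0, r10]; simpa using z0p⟩) T hT.le
  have ChT := Ch T hT.le
  have zTp := zp T
  have ha : E ≤ a := by
    have := ChT.1
    rw [h0, div_self z0p.ne', one_le_div zTp, z0T, hT1.1] at this
    exact le_of_mul_le_mul_right this z0p
  have E0 : 0 < E := by linarith
  have hc : 0 ≤ c := by
    have := ChT.2
    rw [z0T, z1T, hT1.1, hT1.2] at this
    have h2 : 0 ≤ (E * z 0) * c := by linarith
    exact nonneg_of_mul_nonneg_right h2 (by positivity)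
  have hb : 0 ≤ b := by
    have := Cr.1
    rw [r0, zero_div, hT2.1] at this
    have := mul_nonneg this zTp.le
    rw [div_mul_cancel₀ _ zTp.ne'] at this
    exact nonneg_of_mul_nonneg_left this z0p
  have hd : 0 ≤ d := by
    have := Cr.2
    rw [z0T, z1T, hT2.1, hT2.2] at this
    have h2 : 0 ≤ (E * z 0) * d := by linarith
    exact nonneg_of_mul_nonneg_right h2 (by positivity)
  have det : a * d - b * c = 1 := by
    have := hh.wronsk hr T 0
    rw [W0, hT1.1, hT1.2, hT2.1, hT2.2] at this
    have h2 : z 0 * (a * d - b * c) = z 0 * 1 := by linarith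
    exact mul_left_cancel₀ z0p.ne' h2
  have hbc := mul_nonneg hb hc
  have a1 : 1 < a := by linarith
  -- the larger eigenvalue
  have disc : 0 ≤ (a - d) ^ 2 + 4 * (b * c) := by positivity
  obtain ⟨s, hs0, hs⟩ : ∃ s, 0 ≤ s ∧ s ^ 2 = (a - d) ^ 2 + 4 * (b * c) :=
    ⟨Real.sqrt _, Real.sqrt_nonneg _, Real.sq_sqrt disc⟩
  have hsad : |a - d| ≤ s := abs_le_of_sq_le_sq (by linarith) hs0
  obtain ⟨q1, q2⟩ := abs_le.1 hsad
  set θ := (a + d + s) / 2 with hθ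
  have θa : a ≤ θ := by rw [hθ]; linarith
  have θd' : d ≤ θ := by rw [hθ]; linarith
  have θeq : (θ - a) * (θ - d) = b * c := by rw [hθ]; nlinarith
  have θ1 : 1 < θ := by linarith
  have θ0 : 0 < θ := by linarith
  have θd : d < θ := by
    rcases θd'.lt_or_eq with h | h
    · exact h
    · exfalso
      rw [← h, sub_self, mul_zero] at θeq
      nlinarith
  set η := θ⁻¹ with hη
  have ηθ : η * θ = 1 := inv_mul_cancel₀ θ0.ne'
  have η0 : 0 < η := by positivity
  have η1 : η < 1 := inv_lt_one_of_one_lt₀ θ1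
  have tr : η + θ = a + d := by
    have : θ * (η + θ - a - d) = 0 := by nlinarith
    have := (mul_eq_zero.1 this).resolve_left θ0.ne'
    linarith
  -- eigenfunctions
  have hw := hh.comb hr (θ - d) c
  have hf := hh.comb hr b (η - a)
  have wT : ∀ t, (θ - d) * h (t+T) + c * r (t+T) = θ * ((θ - d) * h t + c * r t) := by
    intro t
    have e1 := (hac t).1
    have e2 := (hbd t).1
    rw [e1, e2]
    linear_combination (- h t) * θeq
  have fT : ∀ t, b * h (t+T) + (η - a) * r (t+T) = η * (b * h t + (η - a) * r t) := by
    intro t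
    have e1 := (hac t).1
    have e2 := (hbd t).1
    rw [e1, e2]
    have : η ^ 2 - (a + d) * η + 1 = 0 := by rw [← tr]; linear_combination (-1) * ηθ
    linear_combination (-r t) * this - r t * det
  set w := fun t => (θ - d) * h t + c * r t with hwd
  set f := fun t => b * h t + (η - a) * r t with hfd
  have wpos : ∀ t, 0 ≤ t → 0 < w t := by
    intro t ht
    have q := (Ch t ht).1
    rw [h0, div_self z0p.ne', one_le_div (zp t)] at q
    have hp : 0 < h t := (zp t).trans_le q
    have q' := (cone hz zp hQ hr (Or.inr ⟨by rw [r0], by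
      rw [r0, r10]; simpa using z0p⟩) t ht).1
    rw [r0, zero_div] at q'
    have := mul_nonneg q' (zp t).le
    rw [div_mul_cancel₀ _ (zp t).ne'] at this
    have x1 : 0 < (θ - d) * h t := mul_pos (sub_pos.2 θd) hp
    have x2 := mul_nonneg hc this
    simp only [hwd]; linarith
  set ρ := Real.log θ / T with hρd
  have ρT : ρ * T = Real.log θ := by rw [hρd]; field_simp
  have eθ : Real.exp (ρ * T) = θ := by rw [ρT, Real.exp_log θ0]
  have eη : Real.exp (-(ρ * T)) = η := by rw [Real.exp_neg, eθ]
  have wT' : ∀ t, w (t + T) = θ * w t := wT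
  have fT' : ∀ t, f (t + T) = η * f t := fT
  have c1 : (fun t => Real.exp (-ρ * t) * (Real.exp (ρ * t) * f t)) = f := by
    funext t
    rw [← mul_assoc, ← Real.exp_add]; simp
  have c2 : (fun t => Real.exp (ρ * t) * (Real.exp (-ρ * t) * w t)) = w := by
    funext t
    rw [← mul_assoc, ← Real.exp_add]; simp
  have per2 : Function.Periodic (fun t => Real.exp (-ρ * t) * w t) T := by
    intro t
    simp only [wT']
    rw [show -ρ * (t + T) = -ρ * t + -(ρ * T) by ring, Real.exp_add, eη]
    linear_combination Real.exp (-ρ * t) * w t * ηθ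
  refine ⟨ρ, fun t => Real.exp (ρ * t) * f t, fun t => Real.exp (-ρ * t) * w t, ?_, ?_, ?_, ?_, ?_,
    per2, ?_, fun t => b * h1 t + (η - a) * r1 t, fun t => (θ - d) * h1 t + c * r1 t, ?_, ?_, ?_⟩
  · rw [hρd, le_div_iff₀ hT, Real.le_log_iff_exp_le θ0]; linarith
  · rw [hρd]; exact div_pos (Real.log_pos θ1) hT
  · have := (hf.smooth sQ).1
    exact (by fun_prop : ContDiff ℝ (⊤ : ℕ∞) fun t : ℝ => Real.exp (ρ * t)).mul this
  · have := (hw.smooth sQ).1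
    exact (by fun_prop : ContDiff ℝ (⊤ : ℕ∞) fun t : ℝ => Real.exp (-ρ * t)).mul this
  · intro t
    simp only [fT']
    rw [show ρ * (t + T) = ρ * t + ρ * T by ring, Real.exp_add, eθ]
    linear_combination Real.exp (ρ * t) * f t * ηθ
  · intro t
    obtain ⟨y, hy, hyt⟩ := per2.exists_mem_Ico₀ hT t
    show 0 < Real.exp (-ρ * t) * w t
    rw [hyt]
    exact mul_pos (Real.exp_pos _) (wpos y hy.1)
  · rw [c1]; exact hf
  · rw [c2]; exact hw
  · have e1 := congrFun c1 0
    have e2 := congrFun c2 0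
    rw [e1, e2]
    simp only [hwd, hfd, h0, h10, r0, r10]
    have : 0 < z 0 * (b * c + (a - η) * (θ - d)) :=
      mul_pos z0p (add_pos_of_nonneg_of_pos hbc (mul_pos (by linarith) (by linarith)))
    intro hh
    linarith

theorem fl_unique {Q : ℝ → ℝ} {T ρ P1 P2 ρ' P1' P2'} (hT : 0 < T) (h : Fl Q T ρ P1 P2)
    (h' : Fl Q T ρ' P1' P2') : ρ = ρ' := by
  obtain ⟨hρ, -, -, p1, p2, pos2, f1, g1, hf, hg, hW⟩ := h
  obtain ⟨hρ', -, -, p1', p2', pos2', f1', g1', hf', hg', hW'⟩ := h'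
  obtain ⟨c₁, c₂, hc⟩ := hf.span hg hg' hW
  have e := fun t => (hc t).1
  have eT : ∀ t, Real.exp (ρ' * T) * (c₁ * (Real.exp (-ρ * t) * P1 t)
      + c₂ * (Real.exp (ρ * t) * P2 t)) = Real.exp (-ρ * T) * (c₁ * (Real.exp (-ρ * t) * P1 t))
      + Real.exp (ρ * T) * (c₂ * (Real.exp (ρ * t) * P2 t)) := by
    intro t
    have q := e (t + T)
    rw [← e t]
    rw [p1 t, p2 t, p2' t] at q
    simp only [mul_add, Real.exp_add] at q ⊢
    linear_combination q
  have e1 : 1 < Real.exp (ρ' * T) := Real.one_lt_exp_iff.2 (by positivity)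
  have e2 : Real.exp (-ρ * T) < 1 := Real.exp_lt_one_iff.2 (by nlinarith)
  have e3 : 0 < Real.exp (ρ * T) := Real.exp_pos _
  by_contra hne
  have e4 : Real.exp (ρ' * T) - Real.exp (ρ * T) ≠ 0 := by
    intro h
    have := Real.exp_injective (sub_eq_zero.1 h)
    exact hne (mul_right_cancel₀ hT.ne' this).symm
  -- the combination vanishes identically
  set A := (Real.exp (ρ' * T) - Real.exp (-ρ * T)) * c₁ with hA
  set B := (Real.exp (ρ' * T) - Real.exp (ρ * T)) * c₂ with hB
  have hAB : ∀ t, A * (Real.exp (-ρ * t) * P1 t) + B * (Real.exp (ρ * t) * P2 t) = 0 := by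
    intro t
    linear_combination eT t
  have hAB1 : A * f1 0 + B * g1 0 = 0 := by
    have d := (hf.comb hg A B).1 0
    have : (fun t => A * (Real.exp (-ρ * t) * P1 t) + B * (Real.exp (ρ * t) * P2 t))
        = fun _ => 0 := funext hAB
    rw [this] at d
    exact d.unique (hasDerivAt_const 0 (0:ℝ))
  have hAB0 := hAB 0
  have B0 : B = 0 := by
    have : B * ((Real.exp (-ρ * 0) * P1 0) * g1 0 - f1 0 * (Real.exp (ρ * 0) * P2 0)) = 0 := by
      linear_combination (Real.exp (-ρ * 0) * P1 0) * hAB1 - f1 0 * hAB0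
    exact (mul_eq_zero.1 this).resolve_right hW
  have A0 : A = 0 := by
    have : A * ((Real.exp (-ρ * 0) * P1 0) * g1 0 - f1 0 * (Real.exp (ρ * 0) * P2 0)) = 0 := by
      linear_combination g1 0 * hAB0 - (Real.exp (ρ * 0) * P2 0) * hAB1
    exact (mul_eq_zero.1 this).resolve_right hW
  have c10 : c₁ = 0 := (mul_eq_zero.1 A0).resolve_left (by linarith)
  have c20 : c₂ = 0 := (mul_eq_zero.1 B0).resolve_left e4
  have := e 0
  rw [c10, c20] at this
  have q := mul_pos (Real.exp_pos (ρ' * 0)) (pos2' 0)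
  rw [this] at q
  simp at q

theorem energy_neg {ξ ξ1 : ℝ → ℝ} {m K p T : ℝ} (hK : 0 < K) (hp : 1 < p) (hm : 0 < m)
    (hT : 0 < T) (pos : ∀ t, 0 < ξ t) (per : Function.Periodic ξ T)
    (d0 : ∀ t, HasDerivAt ξ (ξ1 t) t)
    (d1 : ∀ t, HasDerivAt ξ1 (m ^ 2 * ξ t - K * ξ t ^ p) t) (t : ℝ) :
    ξ1 t ^ 2 - m ^ 2 * ξ t ^ 2 + 2 * K / (p + 1) * (ξ t ^ p * ξ t) < 0 := by
  have cξ : Continuous ξ := continuous_iff_continuousAt.2 fun t => (d0 t).continuousAt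
  have hx : ∀ t, ξ t ^ p = ξ t ^ (p - 1) * ξ t := fun t => by
    rw [Real.rpow_sub_one (pos t).ne', div_mul_cancel₀ _ (pos t).ne']
  obtain ⟨t0, -, ht0⟩ := isCompact_Icc.exists_isMinOn (Set.nonempty_Icc.2 hT.le)
    (cξ.continuousOn (s := Set.Icc 0 T))
  have hmin : ∀ s, ξ t0 ≤ ξ s := by
    intro s
    obtain ⟨y, hy, hys⟩ := per.exists_mem_Ico₀ hT s
    rw [hys]
    exact ht0 ⟨hy.1, hy.2.le⟩
  have hcrit : ξ1 t0 = 0 :=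
    IsLocalMin.hasDerivAt_eq_zero (Filter.Eventually.of_forall hmin) (d0 t0)
  have per1 : ξ1 T = ξ1 0 := by
    have e1 : HasDerivAt (fun t => ξ (t + T)) (ξ1 (0+T)) 0 := (d0 (0+T)).comp_add_const 0 T
    have : (fun t => ξ (t + T)) = ξ := funext per
    rw [this] at e1
    simpa using e1.unique (d0 0)
  have h0 : K * ξ t0 ^ (p - 1) ≤ m ^ 2 := by
    by_contra hc
    push Not at hc
    have : StrictAnti ξ1 := by
      refine strictAnti_of_deriv_neg fun s => ?_
      rw [(d1 s).deriv, hx]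
      have h1 : ξ t0 ^ (p-1) ≤ ξ s ^ (p-1) :=
        Real.rpow_le_rpow (pos t0).le (hmin s) (by linarith)
      have h2 := mul_le_mul_of_nonneg_left h1 hK.le
      have := mul_pos (pos s) (show 0 < K * ξ s ^ (p-1) - m^2 by linarith)
      linarith
    exact absurd per1 (this hT).ne
  have hconst : ∀ s, HasDerivAt
      (fun t => ξ1 t ^ 2 - m ^ 2 * ξ t ^ 2 + 2 * K / (p + 1) * ξ t ^ (p + 1)) 0 s := by
    intro s
    have q1 : HasDerivAt (fun t => ξ1 t ^ 2) _ s := (d1 s).pow 2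
    have q2 : HasDerivAt (fun t => ξ t ^ 2) _ s := (d0 s).pow 2
    have q3 : HasDerivAt (fun t => ξ t ^ (p+1)) _ s :=
      (d0 s).rpow_const (p := p + 1) (Or.inl (pos s).ne')
    have q := (q1.sub (q2.const_mul (m^2))).add (q3.const_mul (2 * K / (p + 1)))
    convert! q using 1
    rw [add_sub_cancel_right]
    have : p + 1 ≠ 0 := by linarith
    field_simp
    norm_num
    ring
  have hc := is_const_of_deriv_eq_zero (fun s => (hconst s).differentiableAt)
    (fun s => (hconst s).deriv) t t0
  simp only [hcrit] at hc
  rw [Real.rpow_add_one (pos t).ne', Real.rpow_add_one (pos t0).ne'] at hc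
  rw [hc, hx t0]
  have hp1 : 0 < p + 1 := by linarith
  have h2 : 2 * K / (p + 1) * (ξ t0 ^ (p - 1) * ξ t0 * ξ t0)
      = 2 / (p+1) * (K * ξ t0 ^ (p-1)) * ξ t0 ^ 2 := by ring
  rw [h2]
  have h3 : 2 / (p + 1) < 1 := by rw [div_lt_one hp1]; linarith
  have h4 : 0 < 2 / (p + 1) := by positivity
  have h5 : 0 < ξ t0 ^ 2 := by have := pos t0; positivity
  have h6 : 2 / (p+1) * (K * ξ t0 ^ (p-1)) ≤ 2 / (p+1) * m ^ 2 := by gcongr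
  have h7 : 2 / (p+1) * m ^ 2 < m ^ 2 := by nlinarith [sq_pos_of_pos hm]
  nlinarith [mul_pos h5 (show 0 < m ^ 2 - 2 / (p+1) * (K * ξ t0 ^ (p-1)) by linarith)]

theorem smooth_xi {ξ ξ1 : ℝ → ℝ} {m K p : ℝ} (pos : ∀ t, 0 < ξ t)
    (d0 : ∀ t, HasDerivAt ξ (ξ1 t) t)
    (d1 : ∀ t, HasDerivAt ξ1 (m ^ 2 * ξ t - K * ξ t ^ p) t) :
    ContDiff ℝ (⊤ : ℕ∞) ξ ∧ ContDiff ℝ (⊤ : ℕ∞) ξ1 := by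
  have e0 : deriv ξ = ξ1 := funext fun t => (d0 t).deriv
  have e1 : deriv ξ1 = fun t => m ^ 2 * ξ t - K * ξ t ^ p := funext fun t => (d1 t).deriv
  have D0 : Differentiable ℝ ξ := fun t => (d0 t).differentiableAt
  have D1 : Differentiable ℝ ξ1 := fun t => (d1 t).differentiableAt
  have key : ∀ k : ℕ, ContDiff ℝ k ξ ∧ ContDiff ℝ k ξ1 := by
    intro k
    induction k with
    | zero => exact ⟨contDiff_zero.2 D0.continuous, contDiff_zero.2 D1.continuous⟩
    | succ k ih =>
      push_cast
      rw [contDiff_succ_iff_deriv, contDiff_succ_iff_deriv, e0, e1]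
      refine ⟨⟨D0, by simp, ih.2⟩, D1, by simp, ?_⟩
      exact (contDiff_const.mul ih.1).sub
        (contDiff_const.mul (ih.1.rpow_const_of_ne fun x => (pos x).ne'))
  exact ⟨contDiff_infty.2 fun k => (key k).1, contDiff_infty.2 fun k => (key k).2⟩

theorem xi_deriv_sol {ξ ξ1 : ℝ → ℝ} {m K p : ℝ} (pos : ∀ t, 0 < ξ t)
    (d0 : ∀ t, HasDerivAt ξ (ξ1 t) t)
    (d1 : ∀ t, HasDerivAt ξ1 (m ^ 2 * ξ t - K * ξ t ^ p) t) :
    Sol (fun t => m ^ 2 - p * K * ξ t ^ (p - 1)) ξ1 (fun t => m ^ 2 * ξ t - K * ξ t ^ p) := by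
  refine ⟨d1, fun t => ?_⟩
  have q := ((d0 t).const_mul (m^2)).sub
    (((d0 t).rpow_const (p := p) (Or.inl (pos t).ne')).const_mul K)
  convert! q using 1
  ring

theorem fl_one {ξ ξ1 : ℝ → ℝ} {m K p T : ℝ} (hK : 0 < K) (hp : 1 < p) (hm : 0 < m)
    (hpm : p * m = m + 2)
    (hT : 0 < T) (pos : ∀ t, 0 < ξ t) (per : Function.Periodic ξ T)
    (d0 : ∀ t, HasDerivAt ξ (ξ1 t) t)
    (d1 : ∀ t, HasDerivAt ξ1 (m ^ 2 * ξ t - K * ξ t ^ p) t) :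
    Fl (fun t => 2 * m + 1 + m ^ 2 - p * K * ξ t ^ (p - 1)) T 1
      (fun t => m * ξ t - ξ1 t) (fun t => m * ξ t + ξ1 t) := by
  have hx : ∀ t, ξ t ^ p = ξ t ^ (p - 1) * ξ t := fun t => by
    rw [Real.rpow_sub_one (pos t).ne', div_mul_cancel₀ _ (pos t).ne']
  obtain ⟨s0, s1⟩ := smooth_xi pos d0 d1
  have per1 : Function.Periodic ξ1 T := by
    intro t
    have e1 : HasDerivAt (fun t => ξ (t + T)) (ξ1 (t+T)) t := (d0 (t+T)).comp_add_const t T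
    have : (fun t => ξ (t + T)) = ξ := funext per
    rw [this] at e1
    exact e1.unique (d0 t)
  have en := energy_neg hK hp hm hT pos per d0 d1
  have d2 := (xi_deriv_sol pos d0 d1).2
  have ex : ∀ (r t : ℝ), HasDerivAt (fun t => Real.exp (r * t)) (Real.exp (r * t) * r) t := by
    intro r t
    have := ((hasDerivAt_id t).const_mul r).exp
    simpa using this
  refine ⟨one_pos, (contDiff_const.mul s0).sub s1, (contDiff_const.mul s0).add s1,
    fun t => by simp only [per t, per1 t], fun t => by simp only [per t, per1 t], ?_,
    fun t => Real.exp (-1 * t) * (-(m * ξ t - ξ1 t) + (m * ξ1 t - (m ^ 2 * ξ t - K * ξ t ^ p))),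
    fun t => Real.exp (1 * t) * ((m * ξ t + ξ1 t) + (m * ξ1 t + (m ^ 2 * ξ t - K * ξ t ^ p))),
    ⟨?_, ?_⟩, ⟨?_, ?_⟩, ?_⟩
  · intro t
    have h1 := en t
    have h2 : 0 < 2 * K / (p + 1) * (ξ t ^ p * ξ t) := by
      have := pos t
      positivity
    have h3 : ξ1 t ^ 2 < (m * ξ t) ^ 2 := by nlinarith
    have := (abs_lt_of_sq_lt_sq h3 (mul_pos hm (pos t)).le)
    have := (abs_lt.1 this).1
    linarith
  · intro t
    have q := (ex (-1) t).mul (((d0 t).const_mul m).sub (d1 t))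
    convert! q using 1
    simp only [Pi.add_apply, Pi.sub_apply]
    ring
  · intro t
    have q := (ex (-1) t).mul (((((d0 t).const_mul m).sub (d1 t)).neg).add
      (((d1 t).const_mul m).sub (d2 t)))
    convert! q using 1
    simp only [hx, Pi.add_apply, Pi.neg_apply, Pi.sub_apply]
    linear_combination (-K * Real.exp (-1 * t) * ξ t ^ (p-1) * ξ t) * hpm
  · intro t
    have q := (ex 1 t).mul (((d0 t).const_mul m).add (d1 t))
    convert! q using 1
    simp only [Pi.add_apply, Pi.sub_apply]
    ring
  · intro t
    have q := (ex 1 t).mul ((((d0 t).const_mul m).add (d1 t)).add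
      (((d1 t).const_mul m).add (d2 t)))
    convert! q using 1
    simp only [hx, Pi.add_apply]
    linear_combination (-K * Real.exp (1 * t) * ξ t ^ (p-1) * ξ t) * hpm
  · have h1 := en 0
    have h2 : 2 * K / (p + 1) = K * m / (m + 1) := by
      have : p + 1 ≠ 0 := by linarith
      have : m + 1 ≠ 0 := by linarith
      field_simp
      linarith
    rw [h2] at h1
    have hm1 : 0 < m + 1 := by linarith
    have h3 := mul_pos hm1 (neg_pos.2 h1)
    have h4 : (m + 1) * -(ξ1 0 ^ 2 - m ^ 2 * ξ 0 ^ 2 + K * m / (m + 1) * (ξ 0 ^ p * ξ 0))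
        = -((m+1) * (ξ1 0 ^ 2 - m ^ 2 * ξ 0 ^ 2) + K * m * (ξ 0 ^ p * ξ 0)) := by
      field_simp
    rw [h4] at h3
    simp only [mul_zero, Real.exp_zero, one_mul]
    intro h5
    nlinarith

theorem kerBasis_of {L : (ℝ → ℝ) → ℝ → ℝ} {Q f f1 g g1 : ℝ → ℝ}
    (hL : ∀ h t, L h t = -dtt h t + Q t * h t) (sQ : ContDiff ℝ (⊤ : ℕ∞) Q)
    (hf : Sol Q f f1) (hg : Sol Q g g1) (hW : f 0 * g1 0 - f1 0 * g 0 ≠ 0) :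
    KerBasis L f g := by
  have sol : ∀ {f f1}, Sol Q f f1 → ∀ t, L f t = 0 := by
    intro f f1 hf t
    have d0 : deriv f = f1 := funext fun t => (hf.1 t).deriv
    rw [hL, dtt, d0, (hf.2 t).deriv]
    ring
  have le2 : (2 : WithTop ℕ∞) ≤ ((⊤ : ℕ∞) : WithTop ℕ∞) :=
    WithTop.coe_le_coe.2 (le_top : (2 : ℕ∞) ≤ ⊤)
  refine ⟨(hf.smooth sQ).1.of_le le2, (hg.smooth sQ).1.of_le le2, sol hf, sol hg, ?_, ?_⟩
  · rw [LinearIndependent.pair_iff]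
    intro s t hst
    have e0 : ∀ x, s * f x + t * g x = 0 := fun x => by
      have := congrFun hst x
      simpa using this
    have e1 : s * f1 0 + t * g1 0 = 0 := by
      have d := (hf.comb hg s t).1 0
      rw [show (fun x => s * f x + t * g x) = fun _ => 0 from funext e0] at d
      exact d.unique (hasDerivAt_const 0 (0:ℝ))
    have e00 := e0 0
    constructor
    · have : s * (f 0 * g1 0 - f1 0 * g 0) = 0 := by
        linear_combination g1 0 * e00 - g 0 * e1
      exact (mul_eq_zero.1 this).resolve_right hW
    · have : t * (f 0 * g1 0 - f1 0 * g 0) = 0 := by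
        linear_combination f 0 * e1 - f1 0 * e00
      exact (mul_eq_zero.1 this).resolve_right hW
  · intro h hh hLh
    have D : Differentiable ℝ h := hh.differentiable (by norm_num)
    have D1 : Differentiable ℝ (deriv h) := by
      have : ContDiff ℝ (1 + 1) h := by convert hh using 1; norm_num
      exact ((contDiff_succ_iff_deriv.1 this).2.2).differentiable (by norm_num)
    have hs : Sol Q h (deriv h) := by
      refine ⟨fun t => (D t).hasDerivAt, fun t => ?_⟩
      have := hLh t
      rw [hL, dtt] at this
      have h2 := (D1 t).hasDerivAt
      rwa [show deriv (deriv h) t = Q t * h t by linarith] at h2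
    obtain ⟨c₁, c₂, hc⟩ := hf.span hg hs hW
    exact ⟨c₁, c₂, fun t => (hc t).1⟩

theorem part_one {Q f f1 : ℝ → ℝ} {T M : ℝ} (hT : 0 < T) (sQ : ContDiff ℝ (⊤ : ℕ∞) Q)
    (pQ : Function.Periodic Q T) (bQ : ∀ t, |Q t| ≤ M) (hf : Sol Q f f1)
    (pf : Function.Periodic f T) (nz : ∃ t, f t ≠ 0) :
    ∃ p₂ : ℝ → ℝ, ContDiff ℝ (⊤ : ℕ∞) p₂ ∧ Function.Periodic p₂ T ∧ ∃ c : ℝ, ∃ g1,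
      Sol Q (fun t => p₂ t + c * t * f t) g1 ∧
      f 0 * g1 0 - f1 0 * (p₂ 0 + c * 0 * f 0) ≠ 0 := by
  obtain ⟨g, g1, hg, g0, g10⟩ := exists_sol sQ.continuous bQ (-f1 0) (f 0)
  have W : f 0 * g1 0 - f1 0 * g 0 ≠ 0 := by
    rw [g0, g10]
    intro h
    have h1 : f 0 = 0 := by nlinarith [sq_nonneg (f 0), sq_nonneg (f1 0)]
    have h2 : f1 0 = 0 := by nlinarith [sq_nonneg (f 0), sq_nonneg (f1 0)]
    obtain ⟨y, y1, hy, y0, y10⟩ := exists_sol sQ.continuous bQ 1 0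
    obtain ⟨x, x1, hx, x0, x10⟩ := exists_sol sQ.continuous bQ 0 1
    obtain ⟨c₁, c₂, hc⟩ := hy.span hx hf (by rw [y0, y10, x0, x10]; norm_num)
    obtain ⟨e1, e2⟩ := hc 0
    rw [y0, x0, h1] at e1
    rw [y10, x10, h2] at e2
    obtain ⟨t, ht⟩ := nz
    apply ht
    rw [(hc t).1, show c₁ = 0 by linarith, show c₂ = 0 by linarith]; ring
  have pf1 : f1 T = f1 0 := by
    have e1 : HasDerivAt (fun t => f (t + T)) (f1 (0+T)) 0 := (hf.1 (0+T)).comp_add_const 0 T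
    rw [show (fun t => f (t + T)) = f from funext pf] at e1
    simpa using e1.unique (hf.1 0)
  have pf0 : f T = f 0 := by simpa using pf 0
  obtain ⟨a, b, hab⟩ := hf.span hg (hg.shift pQ) W
  have hb : b = 1 := by
    have w := hf.wronsk hg T 0
    obtain ⟨e1, e2⟩ := hab 0
    simp only [zero_add] at e1 e2
    rw [pf0, pf1, e1, e2] at w
    have : (b - 1) * (f 0 * g1 0 - f1 0 * g 0) = 0 := by linear_combination w
    have := (mul_eq_zero.1 this).resolve_right W
    linarith
  have gT : ∀ t, g (t + T) = a * f t + g t := fun t => by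
    have := (hab t).1
    rw [hb, one_mul] at this
    exact this
  have e : (fun t => (g t - a / T * t * f t) + a / T * t * f t) = g := by funext t; ring
  refine ⟨fun t => g t - a / T * t * f t, ?_, ?_, a / T, g1, ?_, ?_⟩
  · have := (hf.smooth sQ).1
    have := (hg.smooth sQ).1
    fun_prop
  · intro t
    simp only [gT, pf t]
    field_simp
    ring
  · rw [e]; exact hg
  · simpa using W

theorem cum0 (n : ℕ) (hn : 3 ≤ n) : cumHarm n 0 = 1 := by
  unfold cumHarm
  simp only [add_zero, Nat.choose_self]
  rw [Nat.choose_eq_zero_of_lt (by omega)]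

theorem cum1 (n : ℕ) (hn : 3 ≤ n) : cumHarm n 1 = n + 1 := by
  unfold cumHarm
  obtain ⟨k, rfl⟩ := Nat.exists_eq_add_of_le' hn
  simp [show k + 3 - 1 = k + 2 by omega, show k + 3 - 2 = k + 1 by omega]

theorem cum_mono (n : ℕ) : Monotone (cumHarm n) := by
  intro a b hab
  unfold cumHarm
  exact Nat.add_le_add (Nat.choose_le_choose _ (by omega)) (Nat.choose_le_choose _ (by omega))

theorem cum_ge (n : ℕ) (hn : 3 ≤ n) (d : ℕ) : d < cumHarm n d := by
  unfold cumHarm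
  have h : d + 1 ≤ Nat.choose (n - 1 + d) (n - 1) := by
    rw [Nat.choose_symm_add]
    calc d + 1 = Nat.choose (1 + d) d := by simp [add_comm]
      _ ≤ _ := Nat.choose_le_choose _ (by omega)
  omega

theorem deg_spec (n : ℕ) (hn : 3 ≤ n) (i d : ℕ) : d < sphDeg n i ↔ cumHarm n d ≤ i := by
  have hne : {d | i < cumHarm n d}.Nonempty := ⟨i, cum_ge n hn i⟩
  constructor
  · intro h
    by_contra hc
    push Not at hc
    exact absurd (Nat.sInf_le (s := {d | i < cumHarm n d}) hc) (not_le.2 h)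
  · intro h
    by_contra hc
    push Not at hc
    have h1 : i < cumHarm n (sphDeg n i) := Nat.sInf_mem hne
    have := cum_mono n hc
    omega

theorem deg_mono (n : ℕ) (hn : 3 ≤ n) {i j : ℕ} (hij : i ≤ j) : sphDeg n i ≤ sphDeg n j := by
  by_contra hc
  push Not at hc
  have := (deg_spec n hn i _).1 hc
  exact lt_irrefl _ ((deg_spec n hn j _).2 (this.trans hij))

theorem eval_mono (n : ℕ) (hn : 3 ≤ n) {i j : ℕ} (hij : i ≤ j) : sphEval n i ≤ sphEval n j := by
  unfold sphEval
  have h : (sphDeg n i : ℝ) ≤ sphDeg n j := by exact_mod_cast deg_mono n hn hij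
  have hn' : (3 : ℝ) ≤ n := by exact_mod_cast hn
  have h0 : (0 : ℝ) ≤ sphDeg n i := Nat.cast_nonneg _
  apply mul_le_mul h (by linarith) (by linarith) (by linarith)

theorem eval_zero (n : ℕ) (hn : 3 ≤ n) : sphEval n 0 = 0 := by
  have : sphDeg n 0 = 0 := by
    have h : ¬ 0 < sphDeg n 0 := by rw [deg_spec n hn, cum0 n hn]; omega
    omega
  simp [sphEval, this]

theorem eval_one (n : ℕ) (hn : 3 ≤ n) {i : ℕ} (h1 : 1 ≤ i) (h2 : i ≤ n) :
    sphEval n i = n - 1 := by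
  have : sphDeg n i = 1 := by
    have h : 0 < sphDeg n i := by rw [deg_spec n hn, cum0 n hn]; omega
    have h' : ¬ 1 < sphDeg n i := by rw [deg_spec n hn, cum1 n hn]; omega
    omega
  simp [sphEval, this]; ring

theorem eval_large (n : ℕ) (hn : 3 ≤ n) (d i : ℕ) (h : cumHarm n d ≤ i) :
    (d : ℝ) ≤ sphEval n i := by
  have h1 : d + 1 ≤ sphDeg n i := (deg_spec n hn i d).2 h
  have h2 : (d : ℝ) + 1 ≤ sphDeg n i := by exact_mod_cast h1
  have hn' : (3 : ℝ) ≤ n := by exact_mod_cast hn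
  have h0 : (0 : ℝ) ≤ d := Nat.cast_nonneg _
  unfold sphEval
  nlinarith

/-- (Lemma 2.2: kernels of `L_i` at a nonconstant periodic Fowler
solution.) -/
theorem statement_13 (n : ℕ) (hn : 3 ≤ n) (K0 : ℝ) (hK0 : 0 < K0)
    (ξ : ℝ → ℝ) (T : ℝ) (hξ : FowlerXi n K0 ξ T)
    (hnc : ∃ t s : ℝ, ξ t ≠ ξ s) :
    (∃ p₁ p₂ : ℝ → ℝ, ContDiff ℝ (⊤ : ℕ∞) p₁ ∧ ContDiff ℝ (⊤ : ℕ∞) p₂ ∧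
      Function.Periodic p₁ T ∧ Function.Periodic p₂ T ∧ ∃ c : ℝ,
        KerBasis (Lop n K0 ξ (sphEval n 0)) p₁ (fun t => p₂ t + c * t * p₁ t)) ∧
    ∃ ρ : ℕ → ℝ, (∀ i, 1 ≤ i → 0 < ρ i) ∧ (∀ i j, 1 ≤ i → i ≤ j → ρ i ≤ ρ j) ∧
      Tendsto ρ atTop atTop ∧
      ∃ P₁ P₂ : ℕ → ℝ → ℝ,
        (∀ i, 1 ≤ i → ContDiff ℝ (⊤ : ℕ∞) (P₁ i) ∧ ContDiff ℝ (⊤ : ℕ∞) (P₂ i) ∧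
          Function.Periodic (P₁ i) T ∧ Function.Periodic (P₂ i) T ∧
          KerBasis (Lop n K0 ξ (sphEval n i))
            (fun t => Real.exp (-(ρ i) * t) * P₁ i t)
            (fun t => Real.exp (ρ i * t) * P₂ i t)) ∧
        ∀ i, 1 ≤ i → i ≤ n → ρ i = 1 ∧
          P₁ i = (fun t => ((n : ℝ) - 2) / 2 * ξ t - deriv ξ t) ∧
          P₂ i = (fun t => ((n : ℝ) - 2) / 2 * ξ t + deriv ξ t) := by
  obtain ⟨hC, pos, hT, per, heq⟩ := hξ
  have hn3 : (3 : ℝ) ≤ n := by exact_mod_cast hn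
  have hn2 : (n : ℝ) - 2 ≠ 0 := by linarith
  obtain ⟨m, hm⟩ : ∃ m : ℝ, m = ((n : ℝ) - 2) / 2 := ⟨_, rfl⟩
  obtain ⟨p, hpd⟩ : ∃ p : ℝ, p = ((n : ℝ) + 2) / ((n : ℝ) - 2) := ⟨_, rfl⟩
  have hm0 : 0 < m := by rw [hm]; linarith
  have hm2 : ((n : ℝ) - 2) ^ 2 / 4 = m ^ 2 := by rw [hm]; ring
  have hp1 : (4 : ℝ) / ((n : ℝ) - 2) = p - 1 := by rw [hpd]; field_simp; ring
  have hp : 1 < p := by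
    have : 0 < p - 1 := by rw [← hp1]; exact div_pos (by norm_num) (by linarith)
    linarith
  have hpm : p * m = m + 2 := by rw [hpd, hm]; field_simp; ring
  have hmn : 2 * m + 1 = (n : ℝ) - 1 := by rw [hm]; ring
  have D : Differentiable ℝ ξ := hC.differentiable (by norm_num)
  have D1 : Differentiable ℝ (deriv ξ) := by
    have : ContDiff ℝ (1 + 1) ξ := by convert hC using 1; norm_num
    exact ((contDiff_succ_iff_deriv.1 this).2.2).differentiable (by norm_num)
  have d0 : ∀ t, HasDerivAt ξ (deriv ξ t) t := fun t => (D t).hasDerivAt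
  have d1 : ∀ t, HasDerivAt (deriv ξ) (m ^ 2 * ξ t - K0 * ξ t ^ p) t := by
    intro t
    have h1 := heq t
    have h2 := (D1 t).hasDerivAt
    rw [dtt, hm2, ← hpd] at h1
    rwa [show deriv (deriv ξ) t = m ^ 2 * ξ t - K0 * ξ t ^ p by linarith] at h2
  obtain ⟨s0, s1⟩ := smooth_xi pos d0 d1
  set q : ℝ → ℝ := fun t => m ^ 2 - p * K0 * ξ t ^ (p - 1) with hq
  have sq : ContDiff ℝ (⊤ : ℕ∞) q :=
    contDiff_const.sub (contDiff_const.mul (s0.rpow_const_of_ne fun x => (pos x).ne'))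
  have pq : Function.Periodic q T := fun t => by simp only [hq, per t]
  obtain ⟨M, hM⟩ : ∃ M, ∀ t, |q t| ≤ M := by
    obtain ⟨M, hM⟩ := (pq.isBounded_of_continuous hT.ne' sq.continuous).exists_norm_le
    exact ⟨M, fun t => hM _ ⟨t, rfl⟩⟩
  have sQ : ∀ l : ℝ, ContDiff ℝ (⊤ : ℕ∞) (fun t => l + q t) := fun l => contDiff_const.add sq
  have pQ : ∀ l : ℝ, Function.Periodic (fun t => l + q t) T := fun l t => by simp only [pq t]
  have bQ : ∀ l t : ℝ, |l + q t| ≤ |l| + M := fun l t =>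
    (abs_add_le _ _).trans (by have := hM t; linarith)
  have hL : ∀ l h t, Lop n K0 ξ l h t = -dtt h t + (l + q t) * h t := by
    intro l h t
    simp only [Lop, hq, hm2, hp1, ← hpd]
    ring
  have F1 : Fl (fun t => ((n : ℝ) - 1) + q t) T 1
      (fun t => ((n : ℝ) - 2) / 2 * ξ t - deriv ξ t)
      (fun t => ((n : ℝ) - 2) / 2 * ξ t + deriv ξ t) := by
    have := fl_one hK0 hp hm0 hpm hT pos per d0 d1
    rw [← hm]
    convert! this using 1
    funext t
    rw [← hmn]; simp only [hq]; ring
  -- comparison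
  have comp : ∀ {l l' ρ P1 P2}, Fl (fun t => l + q t) T ρ P1 P2 → l ≤ l' →
      ∃ ρ' P1' P2', ρ ≤ ρ' ∧ Fl (fun t => l' + q t) T ρ' P1' P2' := by
    intro l l' ρ P1 P2 h hl
    obtain ⟨hρ, -, -, -, p2, pos2, f1, g1, -, hg, -⟩ := h
    refine fl_exists hT hρ hg (fun t => mul_pos (Real.exp_pos _) (pos2 t)) (fun t => ?_)
      (fun t => by linarith) (sQ l') (pQ l') (bQ l')
    rw [p2 t, mul_add, Real.exp_add]; ring
  constructor
  · have per1 : Function.Periodic (deriv ξ) T := by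
      intro t
      have e1 : HasDerivAt (fun t => ξ (t + T)) (deriv ξ (t+T)) t :=
        (d0 (t+T)).comp_add_const t T
      rw [show (fun t => ξ (t + T)) = ξ from funext per] at e1
      exact e1.unique (d0 t)
    have nz : ∃ t, deriv ξ t ≠ 0 := by
      by_contra hc
      push Not at hc
      obtain ⟨t, s, hts⟩ := hnc
      exact hts (is_const_of_deriv_eq_zero D hc t s)
    have hS := xi_deriv_sol pos d0 d1
    obtain ⟨p₂, sp, pp, c, g1, hg, hW⟩ := part_one hT sq pq hM hS per1 nz
    refine ⟨deriv ξ, p₂, s1, sp, per1, pp, c, ?_⟩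
    exact kerBasis_of (fun h t => by rw [hL, eval_zero n hn, zero_add]) sq hS hg hW
  · have ex : ∀ i : ℕ, ∃ ρ P1 P2, 1 ≤ i → Fl (fun t => sphEval n i + q t) T ρ P1 P2 ∧
        (i ≤ n → ρ = 1 ∧ P1 = (fun t => ((n : ℝ) - 2) / 2 * ξ t - deriv ξ t) ∧
          P2 = (fun t => ((n : ℝ) - 2) / 2 * ξ t + deriv ξ t)) := by
      intro i
      by_cases h1 : 1 ≤ i
      · by_cases h2 : i ≤ n
        · refine ⟨1, _, _, fun _ => ⟨?_, fun _ => ⟨rfl, rfl, rfl⟩⟩⟩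
          rw [eval_one n hn h1 h2]; exact F1
        · have hl : (n : ℝ) - 1 ≤ sphEval n i := by
            rw [← eval_one n hn (le_refl 1) (by omega)]
            exact eval_mono n hn h1
          obtain ⟨ρ, P1, P2, -, hF⟩ := comp F1 hl
          exact ⟨ρ, P1, P2, fun _ => ⟨hF, fun h => absurd h h2⟩⟩
      · exact ⟨0, 0, 0, fun h => absurd h h1⟩
    choose ρ P1 P2 hF using ex
    refine ⟨ρ, fun i hi => (hF i hi).1.1, ?_, ?_, P1, P2, ?_, fun i h1 h2 => (hF i h1).2 h2⟩
    · intro i j hi hij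
      obtain ⟨ρ', P1', P2', hle, hF'⟩ := comp (hF i hi).1 (eval_mono n hn hij)
      rw [fl_unique hT (hF j (hi.trans hij)).1 hF']
      exact hle
    · rw [Filter.tendsto_atTop]
      intro b
      set k := max b 1 with hk
      have k1 : 1 ≤ k := le_max_right _ _
      obtain ⟨d, hd⟩ := exists_nat_ge (k ^ 2 + M)
      filter_upwards [Filter.eventually_ge_atTop (max 1 (cumHarm n d))] with i hi
      have hi1 : 1 ≤ i := (le_max_left _ _).trans hi
      have hl := eval_large n hn d i ((le_max_right _ _).trans hi)
      have ex : ∀ t, HasDerivAt (fun t => Real.exp (k * t)) (k * Real.exp (k * t)) t := by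
        intro t
        have := ((hasDerivAt_id t).const_mul k).exp
        simpa [mul_comm] using this
      have hz : Sol (fun _ => k ^ 2) (fun t => Real.exp (k * t))
          (fun t => k * Real.exp (k * t)) := by
        refine ⟨ex, fun t => ?_⟩
        convert! (ex t).const_mul k using 1
        ring
      have k0 : 0 < k := by linarith
      obtain ⟨ρ', P1', P2', hle, hF'⟩ := fl_exists (ρ₁ := k) hT k0 hz
        (fun t => Real.exp_pos _) (fun t => by rw [mul_add, Real.exp_add, mul_comm])
        (fun t => by have := (abs_le.1 (hM t)).1; linarith)
        (sQ (sphEval n i)) (pQ _) (bQ _)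
      rw [fl_unique hT (hF i hi1).1 hF']
      exact (le_max_left _ _).trans hle
    · intro i hi
      obtain ⟨-, c1, c2, p1, p2, -, f1, g1, hf, hg, hW⟩ := (hF i hi).1
      exact ⟨c1, c2, p1, p2, kerBasis_of (hL (sphEval n i)) (sQ _) hf hg hW⟩
end
end

section
/- Let n ≥ 3, let ξ be a positive solution of (F), and let {ρ_i}_{i≥1} be the associated exponents (so that for each i ≥ 1, Ker(L_i) is spanned by e^{−ρ_i t} p_i^+ and e^{ρ_i t} p_i^− with p_i^± smooth periodic). Then: (i) if ξ is the constant solution, ρ_i^2 = λ_i − n + 2 for all i ≥ 1; (ii) if ξ is a nonconstant periodic solution, then ρ_i^2 > λ_i − (3n−2)/2 for all i ≥ 1. -/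
open Real Set Metric Filter Function

noncomputable section

lemma deriv2_exp_mul (r : ℝ) (p : ℝ → ℝ) (hp : ContDiff ℝ 2 p) (t : ℝ) :
    dtt (fun t => Real.exp (r * t) * p t) t
      = Real.exp (r * t) * (deriv (deriv p) t + 2 * r * deriv p t + r ^ 2 * p t) := by
  have hd : Differentiable ℝ p := hp.differentiable (by norm_num)
  have hd' : Differentiable ℝ (deriv p) := by
    have : ContDiff ℝ 1 (deriv p) := by
      apply ContDiff.deriv' (n := 1)
      exact_mod_cast hp
    exact this.differentiable (by norm_num)
  have he : ∀ t, HasDerivAt (fun t => Real.exp (r * t)) (Real.exp (r * t) * r) t := by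
    intro t
    have := ((hasDerivAt_id t).const_mul r).exp
    simpa using this
  have h1 : deriv (fun t => Real.exp (r * t) * p t)
      = fun t => Real.exp (r * t) * (r * p t + deriv p t) := by
    funext t
    refine Eq.trans ((he t).mul (hd t).hasDerivAt).deriv ?_
    ring
  unfold dtt
  rw [h1]
  have := (he t).mul (((hd t).hasDerivAt.const_mul r).add (hd' t).hasDerivAt)
  have h2 := this.deriv
  refine Eq.trans h2 ?_
  simp only [Pi.add_apply]
  ring

lemma diff_deriv_of_contDiff_two (p : ℝ → ℝ) (hp : ContDiff ℝ 2 p) :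
    Differentiable ℝ p ∧ Differentiable ℝ (deriv p) := by
  refine ⟨hp.differentiable (by norm_num), ?_⟩
  have : ContDiff ℝ 1 (deriv p) := by
    apply ContDiff.deriv' (n := 1)
    exact_mod_cast hp
  exact this.differentiable (by norm_num)

lemma energy_zero (p : ℝ → ℝ) (T r c : ℝ) (hT : 0 < T) (hr : 0 < r) (hc : c ≠ 0)
    (hp : ContDiff ℝ 2 p) (hper : Function.Periodic p T)
    (h : ∀ t, deriv (deriv p) t + 2 * r * deriv p t + c * p t = 0) : ∀ t, p t = 0 := by
  obtain ⟨hd, hd'⟩ := diff_deriv_of_contDiff_two p hp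
  have hper' : ∀ t, deriv p (t + T) = deriv p t := by
    intro t
    rw [← deriv_comp_add_const]
    congr 1
    funext x
    exact hper x
  set E : ℝ → ℝ := fun t => deriv p t ^ 2 + c * p t ^ 2 with hE
  have hEd : ∀ t, HasDerivAt E (-(4 * r) * deriv p t ^ 2) t := by
    intro t
    have := ((hd' t).hasDerivAt.pow 2).add (((hd t).hasDerivAt.pow 2).const_mul c)
    refine this.congr_deriv ?_
    have e := h t
    have e' : deriv (deriv p) t = -(2 * r * deriv p t + c * p t) := by linarith
    rw [e']
    norm_num
    ring
  have hanti : Antitone E := by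
    apply antitone_of_deriv_nonpos
    · exact fun t => (hEd t).differentiableAt
    · intro t
      rw [(hEd t).deriv]
      nlinarith [sq_nonneg (deriv p t)]
  have hEper : Function.Periodic E T := by
    intro t
    simp only [hE]
    rw [hper' t, hper t]
  have hconst : ∀ x y, x ≤ y → E x = E y := by
    intro x y hxy
    apply le_antisymm _ (hanti hxy)
    obtain ⟨k, hk⟩ := exists_nat_gt ((y - x) / T)
    have hk' : y ≤ x + k * T := by
      rw [div_lt_iff₀ hT] at hk
      linarith
    have := hanti hk'
    rwa [hEper.nat_mul k x] at this
  have hzero : ∀ t, deriv p t = 0 := by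
    intro t
    have hE0 : E = fun _ => E t := by
      funext x
      rcases le_total x t with hx | hx
      · exact hconst x t hx
      · exact (hconst t x hx).symm
    have h1 := (hEd t).deriv
    rw [hE0, deriv_const] at h1
    have : deriv p t ^ 2 = 0 := by
      rcases mul_eq_zero.mp h1.symm with h2 | h2
      · linarith
      · exact h2
    exact pow_eq_zero_iff (two_ne_zero) |>.mp this
  intro t
  have h1 := h t
  have : deriv p = fun _ => 0 := funext hzero
  rw [this] at h1
  simp at h1
  exact h1.resolve_left hc

lemma exists_max_periodic (p : ℝ → ℝ) (T : ℝ) (hT : 0 < T) (hp : Continuous p)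
    (hper : Function.Periodic p T) : ∃ t₀, ∀ t, p t ≤ p t₀ := by
  obtain ⟨t₀, _, h⟩ := isCompact_Icc.exists_isMaxOn (s := Set.Icc 0 T)
    ⟨0, by constructor <;> linarith⟩ hp.continuousOn
  refine ⟨t₀, fun t => ?_⟩
  obtain ⟨y, hy, e⟩ := hper.exists_mem_Ico₀ hT t
  rw [e]
  exact h (Set.Ico_subset_Icc_self hy)

lemma deriv2_nonpos_of_max (p : ℝ → ℝ) (hp : ContDiff ℝ 2 p) (t₀ : ℝ) (h : ∀ t, p t ≤ p t₀) :
    deriv p t₀ = 0 ∧ deriv (deriv p) t₀ ≤ 0 := by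
  have hmax : IsLocalMax p t₀ := Filter.Eventually.of_forall h
  refine ⟨hmax.deriv_eq_zero, ?_⟩
  by_contra hcon
  push Not at hcon
  have hmin : IsLocalMin p t₀ :=
    isLocalMin_of_deriv_deriv_pos hcon hmax.deriv_eq_zero hp.continuous.continuousAt
  have heq : p =ᶠ[nhds t₀] fun _ => p t₀ := by
    filter_upwards [hmax, hmin] with x h1 h2 using le_antisymm h1 h2
  have h2 := heq.deriv.deriv_eq
  simp at h2
  linarith

lemma max_principle (p Q : ℝ → ℝ) (T r : ℝ) (hT : 0 < T) (hQ : ∀ t, 0 < Q t)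
    (hp : ContDiff ℝ 2 p) (hper : Function.Periodic p T)
    (h : ∀ t, deriv (deriv p) t + 2 * r * deriv p t = Q t * p t) : ∀ t, p t ≤ 0 := by
  obtain ⟨t₀, ht₀⟩ := exists_max_periodic p T hT hp.continuous hper
  obtain ⟨h1, h2⟩ := deriv2_nonpos_of_max p hp t₀ ht₀
  have h3 := h t₀
  rw [h1] at h3
  have : p t₀ ≤ 0 := by
    by_contra hc
    push Not at hc
    have := mul_pos (hQ t₀) hc
    linarith
  exact fun t => (ht₀ t).trans this

lemma fowler_bound (n : ℕ) (hn : 3 ≤ n) (K0 : ℝ) (ξ : ℝ → ℝ) (T : ℝ)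
    (hξ : FowlerXi n K0 ξ T) (t : ℝ) :
    K0 * ξ t ^ ((4 : ℝ) / ((n : ℝ) - 2)) < n * ((n : ℝ) - 2) / 4 := by
  obtain ⟨hC, hpos, hT, hper, heq⟩ := hξ
  obtain ⟨hd, hd'⟩ := diff_deriv_of_contDiff_two ξ hC
  have hn' : (3 : ℝ) ≤ n := by exact_mod_cast hn
  set m : ℝ := (n : ℝ) - 2 with hm
  have hm0 : 0 < m := by linarith
  have hnm : (n : ℝ) = m + 2 := by linarith
  have heq2 : ∀ t, deriv (deriv ξ) t = (m ^ 2 / 4 - K0 * ξ t ^ (4 / m)) * ξ t := by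
    intro t
    have h1 := heq t
    have h2 : ((n : ℝ) + 2) / m = 4 / m + 1 := by
      rw [hnm]; field_simp; ring
    rw [h2, Real.rpow_add_one (hpos t).ne'] at h1
    unfold dtt at h1
    linarith
  set H : ℝ → ℝ := fun t => deriv ξ t ^ 2 - m ^ 2 / 4 * ξ t ^ 2
    + m / (m + 2) * K0 * ξ t ^ (4 / m + 2) with hH
  have hHd : ∀ t, HasDerivAt H 0 t := by
    intro t
    have := (((hd' t).hasDerivAt.pow 2).sub (((hd t).hasDerivAt.pow 2).const_mul (m ^ 2 / 4))).add
      (((hd t).hasDerivAt.rpow_const (p := 4 / m + 2) (Or.inl (hpos t).ne')).const_mul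
        (m / (m + 2) * K0))
    refine this.congr_deriv ?_
    have e : (4 / m + 2 - 1 : ℝ) = 4 / m + 1 := by ring
    rw [e, Real.rpow_add_one (hpos t).ne', heq2 t]
    norm_num
    field_simp
    ring
  have hHc : ∀ x y, H x = H y :=
    is_const_of_deriv_eq_zero (fun t => (hHd t).differentiableAt) (fun t => (hHd t).deriv)
  have hHf : ∀ t, H t = deriv ξ t ^ 2
      + ξ t ^ 2 * (m / (m + 2) * (K0 * ξ t ^ (4 / m)) - m ^ 2 / 4) := by
    intro t
    simp only [hH]
    rw [Real.rpow_add (hpos t), Real.rpow_two]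
    ring
  obtain ⟨t₀, ht₀⟩ := exists_max_periodic (fun t => -ξ t) T hT hC.continuous.neg
    (fun t => by simp only [hper t])
  obtain ⟨h1, h2⟩ := deriv2_nonpos_of_max (fun t => -ξ t) hC.neg t₀ ht₀
  have hneg : deriv (fun t => -ξ t) = fun t => -deriv ξ t := by
    funext t
    exact deriv.fun_neg
  rw [hneg] at h1 h2
  rw [deriv.fun_neg, heq2 t₀] at h2
  have h1' : deriv ξ t₀ = 0 := by linarith
  have h3 : K0 * ξ t₀ ^ (4 / m) ≤ m ^ 2 / 4 := by
    have : 0 ≤ (m ^ 2 / 4 - K0 * ξ t₀ ^ (4 / m)) * ξ t₀ := by linarith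
    have := nonneg_of_mul_nonneg_left this (hpos t₀)
    linarith
  have hH0 : H t₀ < 0 := by
    rw [hHf, h1']
    have hlt : m / (m + 2) < 1 := by rw [div_lt_one (by linarith)]; linarith
    have hge : 0 < m / (m + 2) := by positivity
    have h4 : m / (m + 2) * (K0 * ξ t₀ ^ (4 / m)) - m ^ 2 / 4 < 0 := by
      have := mul_le_mul_of_nonneg_left h3 hge.le
      have h5 : 0 < m ^ 2 / 4 := by positivity
      nlinarith
    have := mul_neg_of_pos_of_neg (pow_pos (hpos t₀) 2) h4
    linarith
  rw [hHc t₀ t, hHf t] at hH0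
  have h6 : m / (m + 2) * (K0 * ξ t ^ (4 / m)) - m ^ 2 / 4 < 0 := by
    by_contra hc
    push Not at hc
    have := mul_nonneg (sq_nonneg (ξ t)) hc
    nlinarith [sq_nonneg (deriv ξ t)]
  have h7 : m / (m + 2) * (K0 * ξ t ^ (4 / m)) < m / (m + 2) * ((m + 2) * m / 4) := by
    have : m / (m + 2) * ((m + 2) * m / 4) = m ^ 2 / 4 := by field_simp
    linarith
  rw [hnm]
  exact lt_of_mul_lt_mul_left h7 (by positivity)

lemma exponent_reduction (n : ℕ) (K0 : ℝ) (ξ : ℝ → ℝ) (lam r : ℝ) (p : ℝ → ℝ)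
    (hp : ContDiff ℝ 2 p)
    (h : ∀ t, Lop n K0 ξ lam (fun t => Real.exp (r * t) * p t) t = 0) (t : ℝ) :
    deriv (deriv p) t + 2 * r * deriv p t
      = (lam + ((n : ℝ) - 2) ^ 2 / 4
        - ((n : ℝ) + 2) / ((n : ℝ) - 2) * (K0 * ξ t ^ ((4 : ℝ) / ((n : ℝ) - 2))) - r ^ 2) * p t := by
  have h1 := h t
  unfold Lop at h1
  rw [deriv2_exp_mul r p hp t] at h1
  have he := (Real.exp_pos (r * t)).ne'
  apply mul_left_cancel₀ he
  linear_combination -h1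

/-- (Lemma A.1: lower bounds for the exponents `ρ_i`.) -/
theorem statement_14 (n : ℕ) (hn : 3 ≤ n) (K0 : ℝ) (hK0 : 0 < K0)
    (ξ : ℝ → ℝ) (T : ℝ) (hξ : FowlerXi n K0 ξ T)
    (ρ : ℕ → ℝ) (hρ : FowlerExponents n K0 ξ T ρ) :
    ((∀ t s : ℝ, ξ t = ξ s) →
      ∀ i, 1 ≤ i → ρ i ^ 2 = sphEval n i - (n : ℝ) + 2) ∧
    ((∃ t s : ℝ, ξ t ≠ ξ s) →
      ∀ i, 1 ≤ i → ρ i ^ 2 > sphEval n i - (3 * (n : ℝ) - 2) / 2) := by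
  have hn' : (3 : ℝ) ≤ n := by exact_mod_cast hn
  have hm0 : (0 : ℝ) < (n : ℝ) - 2 := by linarith
  obtain ⟨hρ0, _, _, hker⟩ := hρ
  have hbd := fowler_bound n hn K0 ξ T hξ
  obtain ⟨hC, hpos, hT, hper, heq⟩ := hξ
  -- the periodic factor of the growing solution, its equation, and its nontriviality
  have key : ∀ i, 1 ≤ i → ∃ p : ℝ → ℝ, ContDiff ℝ 2 p ∧ Function.Periodic p T ∧
      (¬ ∀ t, p t = 0) ∧ ∀ t, deriv (deriv p) t + 2 * ρ i * deriv p t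
      = (sphEval n i + ((n : ℝ) - 2) ^ 2 / 4
        - ((n : ℝ) + 2) / ((n : ℝ) - 2) * (K0 * ξ t ^ ((4 : ℝ) / ((n : ℝ) - 2)))
        - ρ i ^ 2) * p t := by
    intro i hi
    obtain ⟨p₁, p₂, _, hp₂, _, hper₂, _, _, _, hL, hli, _⟩ := hker i hi
    have hp : ContDiff ℝ 2 p₂ := contDiff_infty.mp hp₂ 2
    refine ⟨p₂, hp, hper₂, ?_, exponent_reduction n K0 ξ _ _ p₂ hp hL⟩
    intro h0
    have := hli.ne_zero 1
    apply this
    funext t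
    simp [h0 t]
  constructor
  · intro hconst i hi
    obtain ⟨p, hp, hpp, hne, hode⟩ := key i hi
    have hval : ∀ t, K0 * ξ t ^ ((4 : ℝ) / ((n : ℝ) - 2)) = ((n : ℝ) - 2) ^ 2 / 4 := by
      intro t
      have h1 := heq t
      have h2 : ((n : ℝ) + 2) / ((n : ℝ) - 2) = 4 / ((n : ℝ) - 2) + 1 := by
        field_simp; ring
      have h3 : ξ = fun _ => ξ t := funext fun s => hconst s t
      have h4 : dtt ξ t = 0 := by
        unfold dtt
        rw [h3]
        simp
      rw [h4, h2, Real.rpow_add_one (hpos t).ne'] at h1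
      apply mul_right_cancel₀ (hpos t).ne'
      linarith
    by_contra hcon
    apply hne
    apply energy_zero p T (ρ i) (ρ i ^ 2 - (sphEval n i - n + 2)) hT (hρ0 i hi)
      (sub_ne_zero.mpr hcon) hp hpp
    intro t
    have h1 := hode t
    rw [hval t] at h1
    have h5 : ((n : ℝ) + 2) / ((n : ℝ) - 2) * (((n : ℝ) - 2) ^ 2 / 4)
        = ((n : ℝ) + 2) * ((n : ℝ) - 2) / 4 := by
      field_simp
    rw [h5] at h1
    linear_combination h1
  · intro _ i hi
    obtain ⟨p, hp, hpp, hne, hode⟩ := key i hi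
    by_contra hcon
    push Not at hcon
    apply hne
    have hQ : ∀ t, 0 < sphEval n i + ((n : ℝ) - 2) ^ 2 / 4
        - ((n : ℝ) + 2) / ((n : ℝ) - 2) * (K0 * ξ t ^ ((4 : ℝ) / ((n : ℝ) - 2)))
        - ρ i ^ 2 := by
      intro t
      have hc : 0 < ((n : ℝ) + 2) / ((n : ℝ) - 2) := by positivity
      have h1 := mul_lt_mul_of_pos_left (hbd t) hc
      have h2 : ((n : ℝ) + 2) / ((n : ℝ) - 2) * (n * ((n : ℝ) - 2) / 4)
          = ((n : ℝ) + 2) * n / 4 := by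
        field_simp
      rw [h2] at h1
      nlinarith
    intro t
    apply le_antisymm
    · exact max_principle p _ T (ρ i) hT hQ hp hpp hode t
    · have hneg : deriv (fun t => -p t) = fun t => -deriv p t := by
        funext t
        exact deriv.fun_neg
      have := max_principle (fun t => -p t) _ T (ρ i) hT hQ hp.neg
        (fun t => by simp only [hpp t]) (by
          intro t
          rw [hneg, deriv.fun_neg]
          linear_combination -(hode t)) t
      linarith
end
end

section
/- Let n ≥ 6 and let ξ be a positive periodic solution of (F) with associated exponents {ρ_i}_{i≥1} and index set 𝓘[ξ] listed as 0 < μ_1 < μ_2 < .... Then ρ_{n+1} > √((n+2)/2) ≥ 2, and consequently the second element of the index set satisfies μ_2 = 2. -/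
open Real Set Metric Filter Function

noncomputable section

/-- Energy of a periodic Fowler solution is positive, in quotient form. -/
theorem fowler_log_deriv (n : ℕ) (hn : 6 ≤ n) (K0 : ℝ) (hK0 : 0 < K0)
    (ξ : ℝ → ℝ) (T : ℝ) (hξ : FowlerXi n K0 ξ T) :
    ∃ y y' : ℝ → ℝ, Function.Periodic y T ∧ (∀ t, HasDerivAt y (y' t) t) ∧
      ∀ t, y' t = ((n : ℝ) - 2) ^ 2 / 4 - K0 * ξ t ^ ((4 : ℝ) / ((n : ℝ) - 2)) - y t ^ 2 ∧
        y t ^ 2 ≤ ((n : ℝ) - 2) ^ 2 / 4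
          - ((n : ℝ) - 2) / n * (K0 * ξ t ^ ((4 : ℝ) / ((n : ℝ) - 2))) := by
  obtain ⟨hC, hpos, hT, hper, heq⟩ := hξ
  have hN : (6 : ℝ) ≤ n := by exact_mod_cast hn
  have hN2 : (n : ℝ) - 2 ≠ 0 := by linarith
  have hN0 : (n : ℝ) ≠ 0 := by linarith
  set r : ℝ := (4 : ℝ) / ((n : ℝ) - 2) with hr
  have hrn : r * ((n : ℝ) - 2) = 4 := by rw [hr]; field_simp
  have hd1 : ∀ t, HasDerivAt ξ (deriv ξ t) t := fun t =>
    ((hC.differentiable (by norm_num)) t).hasDerivAt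
  have hC1 : ContDiff ℝ 1 (deriv ξ) := by
    have : ContDiff ℝ (1 + 1) ξ := by simpa [one_add_one_eq_two] using hC
    exact (contDiff_succ_iff_deriv.1 this).2.2
  have hd2 : ∀ t, HasDerivAt (deriv ξ) (dtt ξ t) t := fun t =>
    ((hC1.differentiable (by norm_num)) t).hasDerivAt
  have hpow : ∀ t, ξ t ^ (((n : ℝ) + 2) / ((n : ℝ) - 2)) = ξ t * ξ t ^ r := by
    intro t
    rw [show ((n : ℝ) + 2) / ((n : ℝ) - 2) = 1 + r by rw [hr]; field_simp; ring,
      Real.rpow_add (hpos t), Real.rpow_one]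
  have hode : ∀ t, dtt ξ t = ((n : ℝ) - 2) ^ 2 / 4 * ξ t - K0 * (ξ t * ξ t ^ r) := by
    intro t
    have := heq t
    rw [hpow] at this
    linarith
  have hW : ∀ t, HasDerivAt (fun t => ξ t ^ r) (r * (deriv ξ t) * ξ t ^ r / ξ t) t := by
    intro t
    have h := (hd1 t).rpow_const (p := r) (Or.inl (hpos t).ne')
    convert h using 1
    rw [Real.rpow_sub_one (hpos t).ne']
    ring
  have hWpos : ∀ t, 0 < ξ t ^ r := fun t => Real.rpow_pos_of_pos (hpos t) _
  set E : ℝ → ℝ := fun t => ((n : ℝ) - 2) ^ 2 / 4 * ξ t ^ 2 - deriv ξ t ^ 2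
    - ((n : ℝ) - 2) / n * K0 * (ξ t ^ r * ξ t ^ 2) with hE
  have hEd : ∀ t, HasDerivAt E 0 t := by
    intro t
    have h := ((((hd1 t).pow 2).const_mul (((n : ℝ) - 2) ^ 2 / 4)).sub ((hd2 t).pow 2)).sub
      (((hW t).mul ((hd1 t).pow 2)).const_mul (((n : ℝ) - 2) / n * K0))
    refine HasDerivAt.congr_deriv (show HasDerivAt E _ t from h) ?_
    rw [hode]
    have hx := (hpos t).ne'
    simp only [Pi.pow_apply]
    generalize ξ t ^ r = W
    rw [hr]
    field_simp
    ring
  have hEc : ∀ t, E t = E 0 := fun t =>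
    is_const_of_deriv_eq_zero (fun t => (hEd t).differentiableAt) (fun t => (hEd t).deriv) t 0
  have hdper : Function.Periodic (deriv ξ) T := by
    intro t
    have : (fun s => ξ (s + T)) = ξ := funext hper
    rw [← deriv_comp_add_const, this]
  have hyper : Function.Periodic (fun t => deriv ξ t / ξ t) T := by
    intro t
    simp only [hdper t, hper t]
  have hyd : ∀ t, HasDerivAt (fun t => deriv ξ t / ξ t)
      (((n : ℝ) - 2) ^ 2 / 4 - K0 * ξ t ^ r - (deriv ξ t / ξ t) ^ 2) t := by
    intro t
    have h := (hd2 t).div (hd1 t) (hpos t).ne'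
    refine HasDerivAt.congr_deriv
      (show HasDerivAt (fun t => deriv ξ t / ξ t) _ t from h) ?_
    rw [hode]
    have hx := (hpos t).ne'
    field_simp
  have hyE : ∀ t, (deriv ξ t / ξ t) ^ 2 = ((n : ℝ) - 2) ^ 2 / 4
      - ((n : ℝ) - 2) / n * (K0 * ξ t ^ r) - E 0 / ξ t ^ 2 := by
    intro t
    rw [← hEc t, hE]
    have hx := (hpos t).ne'
    field_simp
    ring
  have hfrac : ((n : ℝ) - 2) / n < 1 := by
    rw [div_lt_one (by linarith)]; linarith
  have hE0 : 0 ≤ E 0 := by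
    by_contra hlt
    push Not at hlt
    have hanti : StrictAnti (fun t => deriv ξ t / ξ t) := by
      apply strictAnti_of_deriv_neg
      intro t
      rw [(hyd t).deriv, hyE t]
      have h1 : E 0 / ξ t ^ 2 < 0 := div_neg_of_neg_of_pos hlt (by have := hpos t; positivity)
      have h2 : 0 < K0 * ξ t ^ r := mul_pos hK0 (hWpos t)
      nlinarith
    have h1 := hanti hT
    have h2 := hyper 0
    simp only [zero_add] at h2
    simp only [h2] at h1
    exact lt_irrefl _ h1
  refine ⟨fun t => deriv ξ t / ξ t, _, hyper, hyd, fun t => ⟨rfl, ?_⟩⟩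
  have := hyE t
  have h1 : 0 ≤ E 0 / ξ t ^ 2 := by positivity
  linarith

theorem sphDeg_succ (n : ℕ) (hn : 6 ≤ n) : sphDeg n (n + 1) = 2 := by
  obtain ⟨k, rfl⟩ : ∃ k, n = k + 2 := ⟨n - 2, by omega⟩
  have h0 : cumHarm (k + 2) 0 = 1 := by
    simp [cumHarm]
  have h1 : cumHarm (k + 2) 1 = k + 3 := by
    simp [cumHarm]
  have h2 : k + 3 < cumHarm (k + 2) 2 := by
    have e1 : Nat.choose (k + 3) (k + 1) = Nat.choose (k + 2) k + Nat.choose (k + 2) (k + 1) :=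
      Nat.choose_succ_succ _ _
    have e2 : Nat.choose (k + 2) (k + 1) = k + 2 := Nat.choose_succ_self_right (k + 1)
    have e3 : 0 < Nat.choose (k + 2) k := Nat.choose_pos (by omega)
    have e4 : cumHarm (k + 2) 2 = Nat.choose (k + 3) (k + 1) + Nat.choose (k + 2) (k + 1) := rfl
    omega
  unfold sphDeg
  apply le_antisymm
  · exact Nat.sInf_le h2
  · apply le_csInf ⟨2, h2⟩
    intro d hd
    simp only [Set.mem_ofPred_eq] at hd
    by_contra hlt
    have : d = 0 ∨ d = 1 := by omega
    rcases this with rfl | rfl <;> omega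

theorem rho_lower (n : ℕ) (hn : 6 ≤ n) (K0 : ℝ) (hK0 : 0 < K0)
    (ξ : ℝ → ℝ) (T : ℝ) (hξ : FowlerXi n K0 ξ T) (R : ℝ) (p : ℝ → ℝ)
    (hp : ContDiff ℝ 2 p) (hpT : Function.Periodic p T) (hp0 : ∃ t, p t ≠ 0)
    (hL : ∀ t, Lop n K0 ξ (2 * n) (fun t => Real.exp (-R * t) * p t) t = 0) :
    (n : ℝ) + 1 ≤ R ^ 2 := by
  obtain ⟨y, y', hyT, hyd, hy⟩ := fowler_log_deriv n hn K0 hK0 ξ T hξ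
  have hT := hξ.2.2.1
  have hN : (6 : ℝ) ≤ n := by exact_mod_cast hn
  have hN2 : (n : ℝ) - 2 ≠ 0 := by linarith
  have hN0 : (n : ℝ) ≠ 0 := by linarith
  by_contra hlt
  push Not at hlt
  have hd1 : ∀ t, HasDerivAt p (deriv p t) t := fun t =>
    ((hp.differentiable (by norm_num)) t).hasDerivAt
  have hC1 : ContDiff ℝ 1 (deriv p) := by
    have : ContDiff ℝ (1 + 1) p := by simpa [one_add_one_eq_two] using hp
    exact (contDiff_succ_iff_deriv.1 this).2.2
  have hd2 : ∀ t, HasDerivAt (deriv p) (dtt p t) t := fun t =>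
    ((hC1.differentiable (by norm_num)) t).hasDerivAt
  have hexp : ∀ t, HasDerivAt (fun t => Real.exp (-R * t)) (Real.exp (-R * t) * -R) t := by
    intro t
    simpa using (((hasDerivAt_id t).const_mul (-R)).exp)
  have hD1 : deriv (fun t => Real.exp (-R * t) * p t)
      = fun t => Real.exp (-R * t) * (deriv p t - R * p t) := by
    funext t
    refine Eq.trans ((hexp t).mul (hd1 t)).deriv ?_
    ring
  have hD2 : ∀ t, dtt (fun t => Real.exp (-R * t) * p t) t
      = Real.exp (-R * t) * (dtt p t - 2 * R * deriv p t + R ^ 2 * p t) := by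
    intro t
    show deriv (deriv _) t = _
    rw [hD1]
    have := ((hexp t).mul ((hd2 t).sub ((hd1 t).const_mul R))).deriv
    refine Eq.trans this ?_
    simp only [Pi.sub_apply]
    ring
  set Q : ℝ → ℝ := fun t => 2 * (n : ℝ) + ((n : ℝ) - 2) ^ 2 / 4
        - ((n : ℝ) + 2) / ((n : ℝ) - 2) * K0 * ξ t ^ ((4 : ℝ) / ((n : ℝ) - 2)) with hQ
  have hpode : ∀ t, dtt p t = 2 * R * deriv p t - R ^ 2 * p t + Q t * p t := by
    intro t
    have h := hL t
    simp only [Lop] at h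
    rw [hD2] at h
    have h3 : Real.exp (-R * t) *
        (dtt p t - (2 * R * deriv p t - R ^ 2 * p t + Q t * p t)) = 0 := by
      rw [hQ]; linear_combination -h
    have := (mul_eq_zero.1 h3).resolve_left (Real.exp_pos _).ne'
    linarith
  set a : ℝ := (n : ℝ) / ((n : ℝ) - 2) with ha
  have hric : ∀ t, a * y' t + (a * y t) ^ 2 ≤ Q t - ((n : ℝ) + 1) := by
    intro t
    obtain ⟨h1, h2⟩ := hy t
    rw [h1, hQ]
    simp only
    generalize ξ t ^ ((4 : ℝ) / ((n : ℝ) - 2)) = W at *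
    have h3 : 0 ≤ a ^ 2 - a := by
      have : 1 ≤ a := by rw [ha, le_div_iff₀ (by linarith)]; linarith
      nlinarith
    have h4 := mul_le_mul_of_nonneg_left h2 h3
    have h5 : a * (((n : ℝ) - 2) ^ 2 / 4 - K0 * W) +
        (a ^ 2 - a) * (((n : ℝ) - 2) ^ 2 / 4 - ((n : ℝ) - 2) / n * (K0 * W))
        = 2 * (n : ℝ) + ((n : ℝ) - 2) ^ 2 / 4
        - ((n : ℝ) + 2) / ((n : ℝ) - 2) * K0 * W - (n + 1) := by
      rw [ha]; field_simp; ring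
    nlinarith
  have hdper : Function.Periodic (deriv p) T := by
    intro t
    have : (fun s => p (s + T)) = p := funext hpT
    rw [← deriv_comp_add_const, this]
  set F : ℝ → ℝ := fun t => p t * deriv p t - R * p t ^ 2 - a * y t * p t ^ 2 with hF
  have hFd : ∀ t, HasDerivAt F (deriv p t ^ 2 + (Q t - R ^ 2) * p t ^ 2 - a * y' t * p t ^ 2
      - 2 * (a * y t) * p t * deriv p t) t := by
    intro t
    have h := (((hd1 t).mul (hd2 t)).sub (((hd1 t).pow 2).const_mul R)).sub
      (((hyd t).const_mul a).mul ((hd1 t).pow 2))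
    refine HasDerivAt.congr_deriv (show HasDerivAt F _ t from h) ?_
    rw [hpode]
    simp only [Pi.pow_apply]
    ring
  have hFge : ∀ t, ((n : ℝ) + 1 - R ^ 2) * p t ^ 2 ≤ deriv F t := by
    intro t
    rw [(hFd t).deriv]
    have := mul_le_mul_of_nonneg_right (hric t) (sq_nonneg (p t))
    nlinarith [sq_nonneg (deriv p t - a * y t * p t)]
  have hFmono : Monotone F := by
    apply monotone_of_deriv_nonneg (fun t => (hFd t).differentiableAt)
    intro t
    refine le_trans ?_ (hFge t)
    exact mul_nonneg (by linarith) (sq_nonneg _)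
  have hFper : Function.Periodic F T := by
    intro t
    simp only [hF, hpT t, hdper t, hyT t]
  obtain ⟨t, ht⟩ := hp0
  have hFconst : ∀ s, F s = F 0 := by
    intro s
    obtain ⟨z, hz, hz'⟩ := hFper.exists_mem_Ico₀ hT s
    have h1 := hFmono hz.1
    have h2 := hFmono hz.2.le
    have h3 := hFper 0
    rw [zero_add] at h3
    rw [hz']
    linarith
  have h0 : deriv F t = 0 := by
    rw [show F = fun _ => F 0 from funext hFconst]; simp
  have h1 := hFge t
  rw [h0] at h1
  have : 0 < ((n : ℝ) + 1 - R ^ 2) * p t ^ 2 := mul_pos (by linarith) (by positivity)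
  linarith

theorem rho_lower' (n : ℕ) (hn : 6 ≤ n) (K0 : ℝ) (hK0 : 0 < K0)
    (ξ : ℝ → ℝ) (T : ℝ) (hξ : FowlerXi n K0 ξ T)
    (ρ : ℕ → ℝ) (hρ : FowlerExponents n K0 ξ T ρ) : (n : ℝ) + 1 ≤ ρ (n + 1) ^ 2 := by
  obtain ⟨p₁, p₂, h1, -, hT1, -, hb⟩ := hρ.2.2.2 (n + 1) (by omega)
  obtain ⟨-, -, hL, -, hli, -⟩ := hb
  have hl : sphEval n (n + 1) = 2 * n := by
    rw [sphEval, sphDeg_succ n hn]; push_cast; ring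
  rw [hl] at hL
  refine rho_lower n hn K0 hK0 ξ T hξ _ p₁ (contDiff_infty.1 h1 2) hT1 ?_ hL
  by_contra hz
  push Not at hz
  apply hli.ne_zero 0
  funext t
  simp [hz]

theorem index_dichotomy (n : ℕ) (ρ : ℕ → ℝ) (hge : ∀ i, 1 ≤ i → 1 ≤ ρ i)
    (hρ1 : ∀ i, 1 ≤ i → i ≤ n → ρ i = 1) (h2 : ∀ i, n < i → 2 ≤ ρ i)
    (s : ℝ) (hs : s ∈ IndexSet ρ) : s = 1 ∨ 2 ≤ s := by
  obtain ⟨hs0, f, hf, rfl⟩ := hs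
  by_cases hc : ∃ i ∈ f.support, n < i
  · right
    obtain ⟨i, hi, hni⟩ := hc
    have hle : (f i : ℝ) * ρ i ≤ ∑ i ∈ f.support, (f i : ℝ) * ρ i :=
      Finset.single_le_sum (f := fun i => (f i : ℝ) * ρ i)
        (fun j hj => mul_nonneg (Nat.cast_nonneg _) (by linarith [hge j (hf j hj)])) hi
    have hfi : (1 : ℝ) ≤ f i := by
      exact_mod_cast Nat.one_le_iff_ne_zero.2 (Finsupp.mem_support_iff.1 hi)
    nlinarith [h2 i hni]
  · push Not at hc
    have he : ∑ i ∈ f.support, (f i : ℝ) * ρ i = ((∑ i ∈ f.support, f i : ℕ) : ℝ) := by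
      push_cast
      exact Finset.sum_congr rfl fun i hi => by rw [hρ1 i (hf i hi) (hc i hi), mul_one]
    rw [he] at hs0 ⊢
    have hs1 : 0 < ∑ i ∈ f.support, f i := by exact_mod_cast hs0
    by_cases h1 : ∑ i ∈ f.support, f i = 1
    · left; exact_mod_cast h1
    · right
      have : 2 ≤ ∑ i ∈ f.support, f i := by omega
      exact_mod_cast this

/-- (Corollary A.2: for `n ≥ 6` one has `ρ_{n+1} > √((n+2)/2) ≥ 2` and
hence `μ₂ = 2`.) -/
theorem statement_15 (n : ℕ) (hn : 6 ≤ n) (K0 : ℝ) (hK0 : 0 < K0)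
    (ξ : ℝ → ℝ) (T : ℝ) (hξ : FowlerXi n K0 ξ T)
    (ρ : ℕ → ℝ) (hρ : FowlerExponents n K0 ξ T ρ)
    (hρ1 : ∀ i, 1 ≤ i → i ≤ n → ρ i = 1)
    (μ : ℕ → ℝ)
    (hμmono : ∀ i j : ℕ, 1 ≤ i → i < j → μ i < μ j)
    (hμmem : ∀ i : ℕ, 1 ≤ i → μ i ∈ IndexSet ρ)
    (hμsurj : ∀ s ∈ IndexSet ρ, ∃ i : ℕ, 1 ≤ i ∧ μ i = s) :
    Real.sqrt (((n : ℝ) + 2) / 2) < ρ (n + 1) ∧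
    2 ≤ Real.sqrt (((n : ℝ) + 2) / 2) ∧
    μ 2 = 2 := by
  have hN : (6 : ℝ) ≤ n := by exact_mod_cast hn
  have hlow := rho_lower' n hn K0 hK0 ξ T hξ ρ hρ
  have hpos := hρ.1 (n + 1) (by omega)
  have hA : Real.sqrt (((n : ℝ) + 2) / 2) < ρ (n + 1) := by
    rw [Real.sqrt_lt' hpos]; linarith
  have hB : 2 ≤ Real.sqrt (((n : ℝ) + 2) / 2) := by
    apply Real.le_sqrt_of_sq_le; linarith
  refine ⟨hA, hB, ?_⟩
  have hone : ρ 1 = 1 := hρ1 1 le_rfl (by omega)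
  have hdich := index_dichotomy n ρ (fun i hi => hone ▸ hρ.2.1 1 i le_rfl hi) hρ1
    (fun i hi => by linarith [hρ.2.1 (n + 1) i (by omega) hi])
  have hmem : ∀ k : ℕ, 0 < k → (k : ℝ) ∈ IndexSet ρ := by
    intro k hk
    refine ⟨by exact_mod_cast hk, Finsupp.single 1 k, ?_, ?_⟩
    · intro i hi
      rw [Finsupp.support_single _ hk.ne', Finset.mem_singleton] at hi
      omega
    · rw [Finsupp.support_single _ hk.ne']
      simp [hone]
  obtain ⟨i, hi, hi1⟩ := hμsurj 1 (by simpa using hmem 1 one_pos)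
  obtain ⟨j, hj, hj2⟩ := hμsurj 2 (by simpa using hmem 2 two_pos)
  have h1 := hdich _ (hμmem 1 le_rfl)
  have h2 := hdich _ (hμmem 2 (by norm_num))
  have h12 := hμmono 1 2 le_rfl (by norm_num)
  have hμ1 : μ 1 = 1 := by
    rcases Nat.lt_or_ge 1 i with h | h
    · have := hμmono 1 i le_rfl h
      rcases h1 with h1 | h1 <;> linarith
    · have : i = 1 := by omega
      rw [← this, hi1]
  have h2' : 2 ≤ μ 2 := by
    rcases h2 with h2 | h2 <;> linarith
  rcases Nat.lt_trichotomy j 2 with h | h | h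
  · have : j = 1 := by omega
    rw [this] at hj2; linarith
  · rw [← h, hj2]
  · have := hμmono 2 j (by norm_num) h
    linarith
end
end

section
/- Assume n ≥ 3, 0 ≤ a < (n−2)/2, a ≤ b < a+1 and p = 2n/(n−2+2(b−a)), and let ζ be a positive nonconstant periodic solution of (Z). Then the kernel of 𝓛_0 has a basis q_0^+ and q_0^− + c t q_0^+, for some smooth periodic functions q_0^+ and q_0^− on ℝ with the same period as ζ, and some constant c. -/
open Real Set Metric Filter Function

noncomputable section

theorem aux_energy_pos (u w V : ℝ → ℝ) (hV : Continuous V)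
    (hu : ∀ t, HasDerivAt u (w t) t) (hw : ∀ t, HasDerivAt w (V t * u t) t)
    (hne : ∃ t, u t ≠ 0) (t : ℝ) : 0 < u t ^ 2 + w t ^ 2 := by
  by_contra hcon
  have h0 : u t ^ 2 + w t ^ 2 = 0 := le_antisymm (not_lt.1 hcon) (by positivity)
  obtain ⟨s, hs⟩ := hne
  have hspos : 0 < u s ^ 2 + w s ^ 2 := by positivity
  let K : ℝ → ℝ := fun x => ∫ y in (0 : ℝ)..x, |1 + V y|
  have hc : Continuous fun y => |1 + V y| := by fun_prop
  have hK : ∀ x, HasDerivAt K (|1 + V x|) x := fun x =>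
    intervalIntegral.integral_hasDerivAt_right (hc.intervalIntegrable _ _)
      (hc.stronglyMeasurableAtFilter _ _) hc.continuousAt
  have hr : ∀ x, HasDerivAt (fun y => u y ^ 2 + w y ^ 2) (2 * (u x * w x) * (1 + V x)) x := by
    intro x
    have := ((hu x).pow 2).add ((hw x).pow 2)
    refine this.congr_deriv ?_
    simp; ring
  have hbd : ∀ x, |2 * (u x * w x) * (1 + V x)| ≤ (u x ^ 2 + w x ^ 2) * |1 + V x| := by
    intro x
    rw [abs_mul]
    apply mul_le_mul_of_nonneg_right _ (abs_nonneg _)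
    rw [abs_le]
    constructor <;> nlinarith [sq_nonneg (u x + w x), sq_nonneg (u x - w x)]
  have hmono : Monotone fun x => (u x ^ 2 + w x ^ 2) * Real.exp (K x) := by
    have hd : ∀ x, HasDerivAt (fun x => (u x ^ 2 + w x ^ 2) * Real.exp (K x)) _ x :=
      fun x => (hr x).mul (hK x).exp
    apply monotone_of_deriv_nonneg (fun x => (hd x).differentiableAt)
    intro x
    rw [(hd x).deriv]
    have h1 := (abs_le.1 (hbd x)).1
    have h2 := Real.exp_pos (K x)
    nlinarith
  have hanti : Antitone fun x => (u x ^ 2 + w x ^ 2) * Real.exp (-K x) := by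
    have hd : ∀ x, HasDerivAt (fun x => (u x ^ 2 + w x ^ 2) * Real.exp (-K x)) _ x :=
      fun x => (hr x).mul (hK x).neg.exp
    apply antitone_of_deriv_nonpos (fun x => (hd x).differentiableAt)
    intro x
    rw [(hd x).deriv]
    have h1 := (abs_le.1 (hbd x)).2
    have h2 := Real.exp_pos (-K x)
    rw [Pi.neg_apply]
    nlinarith
  rcases le_total s t with h | h
  · have h3 := hmono h
    simp only [h0, zero_mul] at h3
    have := mul_pos hspos (Real.exp_pos (K s))
    linarith
  · have h3 := hanti h
    simp only [h0, zero_mul] at h3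
    have := mul_pos hspos (Real.exp_pos (-K s))
    linarith

theorem aux_contDiff (f f' : ℝ → ℝ) (h : ∀ t, HasDerivAt f (f' t) t)
    (hf' : ContDiff ℝ (⊤ : ℕ∞) f') : ContDiff ℝ (⊤ : ℕ∞) f := by
  rw [contDiff_infty_iff_deriv]
  refine ⟨fun t => (h t).differentiableAt, ?_⟩
  rwa [show deriv f = f' from funext fun t => (h t).deriv]

/-- Second solution with unit Wronskian (Rofe-Beketov formula). -/
theorem aux_second (u w V : ℝ → ℝ) (hV : ContDiff ℝ (⊤ : ℕ∞) V)
    (hus : ContDiff ℝ (⊤ : ℕ∞) u) (hws : ContDiff ℝ (⊤ : ℕ∞) w)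
    (hu : ∀ t, HasDerivAt u (w t) t) (hw : ∀ t, HasDerivAt w (V t * u t) t)
    (hne : ∃ t, u t ≠ 0) :
    ∃ g k : ℝ → ℝ, ContDiff ℝ (⊤ : ℕ∞) g ∧ (∀ t, HasDerivAt g (k t) t) ∧
      (∀ t, HasDerivAt k (V t * g t) t) ∧ ∀ t, u t * k t - w t * g t = 1 := by
  have hpos := aux_energy_pos u w V hV.continuous hu hw hne
  have hne' : ∀ t, u t ^ 2 + w t ^ 2 ≠ 0 := fun t => (hpos t).ne'
  let B : ℝ → ℝ := fun x => (1 + V x) * (u x ^ 2 - w x ^ 2) / (u x ^ 2 + w x ^ 2) ^ 2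
  have hB : ContDiff ℝ (⊤ : ℕ∞) B := by
    apply ContDiff.div
    · fun_prop
    · fun_prop
    · intro x; exact pow_ne_zero 2 (hne' x)
  let A : ℝ → ℝ := fun x => ∫ y in (0 : ℝ)..x, B y
  have hA : ∀ x, HasDerivAt A (B x) x := fun x =>
    intervalIntegral.integral_hasDerivAt_right (hB.continuous.intervalIntegrable _ _)
      (hB.continuous.stronglyMeasurableAtFilter _ _) hB.continuous.continuousAt
  have hAs := aux_contDiff A B hA hB
  have hr : ∀ x, HasDerivAt (fun y => u y ^ 2 + w y ^ 2) (2 * (u x * w x) * (1 + V x)) x := by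
    intro x
    have := ((hu x).pow 2).add ((hw x).pow 2)
    refine this.congr_deriv ?_
    simp; ring
  refine ⟨fun x => A x * u x - w x / (u x ^ 2 + w x ^ 2),
    fun x => A x * w x + u x / (u x ^ 2 + w x ^ 2), ?_, ?_, ?_, ?_⟩
  · apply (hAs.mul hus).sub
    apply hws.div _ hne'
    fun_prop
  · intro x
    refine (((hA x).mul (hu x)).sub ((hw x).div (hr x) (hne' x))).congr_deriv ?_
    have := hne' x
    simp only [B]
    field_simp
    ring
  · intro x
    refine (((hA x).mul (hw x)).add ((hu x).div (hr x) (hne' x))).congr_deriv ?_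
    have := hne' x
    simp only [B]
    field_simp
    ring
  · intro x
    have := hne' x
    field_simp
    ring

theorem aux_wronskian (f f' g g' V : ℝ → ℝ) (hf : ∀ t, HasDerivAt f (f' t) t)
    (hf' : ∀ t, HasDerivAt f' (V t * f t) t) (hg : ∀ t, HasDerivAt g (g' t) t)
    (hg' : ∀ t, HasDerivAt g' (V t * g t) t) :
    ∃ c : ℝ, ∀ t, f t * g' t - f' t * g t = c := by
  refine ⟨f 0 * g' 0 - f' 0 * g 0, fun t => ?_⟩
  have hd : ∀ x, HasDerivAt (fun x => f x * g' x - f' x * g x) 0 x := fun x => by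
    refine (((hf x).mul (hg' x)).sub ((hf' x).mul (hg x))).congr_deriv ?_
    ring
  exact is_const_of_deriv_eq_zero (fun x => (hd x).differentiableAt) (fun x => (hd x).deriv) t 0

theorem aux_span (u w g k h h' V : ℝ → ℝ)
    (hu : ∀ t, HasDerivAt u (w t) t) (hw : ∀ t, HasDerivAt w (V t * u t) t)
    (hg : ∀ t, HasDerivAt g (k t) t) (hk : ∀ t, HasDerivAt k (V t * g t) t)
    (hh : ∀ t, HasDerivAt h (h' t) t) (hh' : ∀ t, HasDerivAt h' (V t * h t) t)
    (hW : ∀ t, u t * k t - w t * g t = 1) :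
    ∃ c₁ c₂ : ℝ, (∀ t, h t = c₁ * u t + c₂ * g t) ∧ ∀ t, u t * h' t - w t * h t = c₂ := by
  obtain ⟨c₁, h1⟩ := aux_wronskian h h' g k V hh hh' hg hk
  obtain ⟨c₂, h2⟩ := aux_wronskian u w h h' V hu hw hh hh'
  refine ⟨c₁, c₂, fun t => ?_, h2⟩
  rw [← h1 t, ← h2 t]
  linear_combination (-h t) * hW t

theorem aux_smooth (ζ : ℝ → ℝ) (κ q : ℝ) (h2 : ContDiff ℝ 2 ζ) (hpos : ∀ t, 0 < ζ t)
    (hd : ∀ t, HasDerivAt (deriv ζ) (κ * ζ t - ζ t ^ q) t) : ContDiff ℝ (⊤ : ℕ∞) ζ := by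
  rw [contDiff_infty]
  intro m
  induction m with
  | zero => exact h2.of_le (by simp)
  | succ m ih =>
    have hF : ContDiff ℝ m (fun t => κ * ζ t - ζ t ^ q) :=
      (contDiff_const.mul ih).sub (ih.rpow_const_of_ne fun t => (hpos t).ne')
    have hw : ContDiff ℝ (m + 1 : ℕ) (deriv ζ) := by
      push_cast
      rw [contDiff_succ_iff_deriv]
      refine ⟨fun t => (hd t).differentiableAt, by simp, ?_⟩
      rwa [show deriv (deriv ζ) = _ from funext fun t => (hd t).deriv]
    push_cast
    rw [contDiff_succ_iff_deriv]
    exact ⟨h2.differentiable (by norm_num), by simp, hw.of_le (by exact_mod_cast Nat.le_succ m)⟩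

theorem aux_sphEval (n : ℕ) : sphEval n 0 = 0 := by
  have : sphDeg n 0 = 0 := by
    apply Nat.sInf_eq_zero.2
    left
    simp [cumHarm]
  simp [sphEval, this]

theorem aux_c2 (h : ℝ → ℝ) (hh : ContDiff ℝ 2 h) :
    (∀ t, HasDerivAt h (deriv h t) t) ∧ ∀ t, HasDerivAt (deriv h) (dtt h t) t := by
  have h1 : ContDiff ℝ (1 + 1) h := by simpa [one_add_one_eq_two] using hh
  rw [contDiff_succ_iff_deriv] at h1
  exact ⟨fun t => (h1.1 t).hasDerivAt,
    fun t => ((h1.2.2.differentiable (by norm_num)) t).hasDerivAt⟩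

/-- (Lemma B.4: the kernel of `𝓛_0` at a nonconstant periodic solution
of the CKN Fowler equation.) -/
theorem statement_17 (n : ℕ) (hn : 3 ≤ n) (a b p : ℝ)
    (ha0 : 0 ≤ a) (ha : a < ((n : ℝ) - 2) / 2) (hab : a ≤ b) (hb : b < a + 1)
    (hp : p = 2 * (n : ℝ) / ((n : ℝ) - 2 + 2 * (b - a)))
    (ζ : ℝ → ℝ) (T : ℝ) (hζ : ZetaSol n a p ζ T)
    (hnc : ∃ t s : ℝ, ζ t ≠ ζ s) :
    ∃ q₁ q₂ : ℝ → ℝ, ContDiff ℝ (⊤ : ℕ∞) q₁ ∧ ContDiff ℝ (⊤ : ℕ∞) q₂ ∧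
      Function.Periodic q₁ T ∧ Function.Periodic q₂ T ∧ ∃ c : ℝ,
        KerBasis (LopCKN n a p ζ (sphEval n 0)) q₁ (fun t => q₂ t + c * t * q₁ t) := by
  obtain ⟨h2, hpos, hT, hper, heq⟩ := hζ
  obtain ⟨hζ1, hζ2⟩ := aux_c2 ζ h2
  set κ : ℝ := ((n : ℝ) - 2 * a - 2) ^ 2 / 4 with hκ
  have hζ2' : ∀ t, HasDerivAt (deriv ζ) (κ * ζ t - ζ t ^ (p - 1)) t := fun t =>
    (hζ2 t).congr_deriv (by linarith [heq t])
  have hsm := aux_smooth ζ κ (p - 1) h2 hpos hζ2'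
  let V : ℝ → ℝ := fun t => κ - (p - 1) * ζ t ^ (p - 2)
  let w : ℝ → ℝ := fun t => κ * ζ t - ζ t ^ (p - 1)
  have hne : ∀ t, ζ t ≠ 0 := fun t => (hpos t).ne'
  have hVs : ContDiff ℝ (⊤ : ℕ∞) V :=
    contDiff_const.sub (contDiff_const.mul (hsm.rpow_const_of_ne hne))
  have hws : ContDiff ℝ (⊤ : ℕ∞) w :=
    (contDiff_const.mul hsm).sub (hsm.rpow_const_of_ne hne)
  have hus : ContDiff ℝ (⊤ : ℕ∞) (deriv ζ) := (contDiff_infty_iff_deriv.1 hsm).2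
  have hw : ∀ t, HasDerivAt w (V t * deriv ζ t) t := fun t => by
    refine (((hζ1 t).const_mul κ).sub ((hζ1 t).rpow_const (p := p - 1) (Or.inl (hne t)))).congr_deriv ?_
    simp only [V]
    rw [show p - 1 - 1 = p - 2 by ring]
    ring
  have hune : ∃ t, deriv ζ t ≠ 0 := by
    by_contra hcon
    push Not at hcon
    obtain ⟨t, s, hts⟩ := hnc
    exact hts (is_const_of_deriv_eq_zero (fun t => (hζ1 t).differentiableAt) hcon t s)
  obtain ⟨g, k, hgs, hg, hk, hW⟩ := aux_second (deriv ζ) w V hVs hus hws hζ2' hw hune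
  have huper : Function.Periodic (deriv ζ) T := fun t => by
    rw [← deriv_comp_add_const, show (fun x => ζ (x + T)) = ζ from funext hper]
  have hwper : ∀ t, w (t + T) = w t := fun t => by simp only [w, hper t]
  have hVper : ∀ t, V (t + T) = V t := fun t => by simp only [V, hper t]
  have hL : ∀ h : ℝ → ℝ, ∀ t,
      LopCKN n a p ζ (sphEval n 0) h t = -dtt h t + V t * h t := fun h t => by
    simp only [LopCKN, aux_sphEval, V, hκ, zero_add]
  -- the shifted solution
  obtain ⟨d₁, d₂, hd, hd₂⟩ := aux_span (deriv ζ) w g k (fun t => g (t + T)) (fun t => k (t + T)) V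
    hζ2' hw hg hk (fun t => (hg (t + T)).comp_add_const t T)
    (fun t => by rw [← hVper t]; exact (hk (t + T)).comp_add_const t T) hW
  have hd2 : d₂ = 1 := by
    rw [← hd₂ 0, ← hW (0 + T), huper 0, hwper 0]
  subst hd2
  have hG : (fun t => (g t - d₁ / T * t * deriv ζ t) + d₁ / T * t * deriv ζ t) = g := by
    funext t; ring
  have hdtt : ∀ f f' f'' : ℝ → ℝ, (∀ t, HasDerivAt f (f' t) t) → (∀ t, HasDerivAt f' (f'' t) t) →
      ∀ t, dtt f t = f'' t := fun f f' f'' h h' t => by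
    rw [dtt, show deriv f = f' from funext fun t => (h t).deriv, (h' t).deriv]
  refine ⟨deriv ζ, fun t => g t - d₁ / T * t * deriv ζ t, hus, ?_, huper, ?_, d₁ / T, ?_⟩
  · exact hgs.sub ((contDiff_const.mul contDiff_id).mul hus)
  · intro t
    have h3 := hd t
    simp only [h3, huper t]
    field_simp
    ring
  · rw [hG]
    refine ⟨contDiff_infty.1 hus 2, contDiff_infty.1 hgs 2,
      ?_, ?_, ?_, ?_⟩
    · intro t; rw [hL, hdtt _ _ _ hζ2' hw]; ring
    · intro t; rw [hL, hdtt _ _ _ hg hk]; ring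
    · rw [LinearIndependent.pair_iff]
      intro x y hxy
      have e1 : ∀ t, x * deriv ζ t + y * g t = 0 := fun t => by
        simpa using congrFun hxy t
      have e2 : ∀ t, x * w t + y * k t = 0 := fun t => by
        have hD := ((hζ2' t).const_mul x).add ((hg t).const_mul y)
        have hz : (fun t => x * deriv ζ t) + (fun t => y * g t) = fun _ => 0 := funext e1
        rw [hz] at hD
        exact hD.unique (hasDerivAt_const t (0 : ℝ))
      constructor
      · linear_combination (-x) * hW 0 + k 0 * e1 0 - g 0 * e2 0
      · linear_combination (-y) * hW 0 + deriv ζ 0 * e2 0 - w 0 * e1 0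
    · intro h hh hh0
      obtain ⟨hh1, hh2⟩ := aux_c2 h hh
      obtain ⟨c₁, c₂, hc, -⟩ := aux_span (deriv ζ) w g k h (deriv h) V hζ2' hw hg hk hh1
        (fun t => (hh2 t).congr_deriv (by have := hh0 t; rw [hL] at this; linarith)) hW
      exact ⟨c₁, c₂, hc⟩
end
end
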